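/- arXiv:0803.0049 — 2 statements merged into one kernel-verified Lean document; each statement's English description precedes it below -/
import Mathlib

section
/- Let Λ ⊂ ℝ with 0 ∈ Λ, and suppose Λ − Λ is δ-separated for some δ > 0 (any two distinct elements of Λ − Λ differ by at least δ) and Λ has positive upper asymptotic density. Then for every N there exist λ₁ < λ₂ < ⋯ < λ_N in Λ forming an arithmetic progression. -/
open Combinatorics

namespace Szem

open Classical in
/-- Indicator of a proposition. -/
noncomputable def ind (P : Prop) : ℝ := if P then 1 else 0

theorem ind_nonneg (P : Prop) : 0 ≤ ind P := by unfold ind; split_ifs <;> norm_num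
theorem ind_le_one (P : Prop) : ind P ≤ 1 := by unfold ind; split_ifs <;> norm_num
theorem ind_true {P : Prop} (h : P) : ind P = 1 := by simp [ind, h]
theorem ind_false {P : Prop} (h : ¬ P) : ind P = 0 := by simp [ind, h]
theorem ind_mono {P Q : Prop} (h : P → Q) : ind P ≤ ind Q := by
  by_cases hP : P
  · simp [ind, hP, h hP]
  · rw [ind_false hP]; exact ind_nonneg _
theorem ind_and (P Q : Prop) : ind (P ∧ Q) = ind P * ind Q := by
  by_cases hP : P <;> by_cases hQ : Q <;> simp [ind, hP, hQ]
theorem ind_not (P : Prop) : ind (¬ P) = 1 - ind P := by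
  by_cases hP : P <;> simp [ind, hP]

/-- Average over a finite type. -/
noncomputable def E {X : Type*} [Finite X] (f : X → ℝ) : ℝ :=
  letI := Fintype.ofFinite X
  (∑ x, f x) / Fintype.card X

theorem E_eq {X : Type*} [Fintype X] (f : X → ℝ) : E f = (∑ x, f x) / Fintype.card X := by
  unfold E
  congr!

section
variable {X Y : Type*} [Finite X] [Finite Y]

theorem E_add (f g : X → ℝ) : E (fun x => f x + g x) = E f + E g := by
  have := Fintype.ofFinite X
  simp only [E_eq, Finset.sum_add_distrib, add_div]

theorem E_sub (f g : X → ℝ) : E (fun x => f x - g x) = E f - E g := by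
  have := Fintype.ofFinite X
  simp only [E_eq, Finset.sum_sub_distrib, sub_div]

theorem E_mul (c : ℝ) (f : X → ℝ) : E (fun x => c * f x) = c * E f := by
  have := Fintype.ofFinite X
  simp only [E_eq, ← Finset.mul_sum, mul_div_assoc]

theorem E_const [Nonempty X] (c : ℝ) : E (fun _ : X => c) = c := by
  have := Fintype.ofFinite X
  simp [E_eq]

theorem E_mono {f g : X → ℝ} (h : ∀ x, f x ≤ g x) : E f ≤ E g := by
  have := Fintype.ofFinite X
  simp only [E_eq]
  gcongr
  exact h _

theorem E_nonneg {f : X → ℝ} (h : ∀ x, 0 ≤ f x) : 0 ≤ E f := by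
  have := Fintype.ofFinite X
  simp only [E_eq]
  exact div_nonneg (Finset.sum_nonneg fun x _ => h x) (by positivity)

theorem E_le_const [Nonempty X] {f : X → ℝ} {c : ℝ} (h : ∀ x, f x ≤ c) : E f ≤ c :=
  (E_mono h).trans (E_const c).le

theorem const_le_E [Nonempty X] {f : X → ℝ} {c : ℝ} (h : ∀ x, c ≤ f x) : c ≤ E f :=
  (E_const c).ge.trans (E_mono h)

theorem E_equiv (e : X ≃ Y) (f : Y → ℝ) : E (fun x => f (e x)) = E f := by
  have := Fintype.ofFinite X
  have := Fintype.ofFinite Y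
  simp only [E_eq, Fintype.card_congr e, Equiv.sum_comp e f]

theorem E_prod (f : X × Y → ℝ) : E f = E fun x => E fun y => f (x, y) := by
  have := Fintype.ofFinite X
  have := Fintype.ofFinite Y
  simp only [E_eq, Fintype.sum_prod_type, Fintype.card_prod, ← Finset.sum_div, Nat.cast_mul]
  rw [div_div, mul_comm]

theorem E_comm (f : X → Y → ℝ) : (E fun x => E fun y => f x y) = E fun y => E fun x => f x y := by
  have := Fintype.ofFinite X
  have := Fintype.ofFinite Y
  simp only [E_eq, ← Finset.sum_div]
  rw [Finset.sum_comm, div_right_comm]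

theorem E_sum {V : Type*} [Fintype V] (f : V → X → ℝ) :
    (E fun x => ∑ v, f v x) = ∑ v, E (f v) := by
  have := Fintype.ofFinite X
  simp only [E_eq, ← Finset.sum_div]
  rw [Finset.sum_comm]

theorem exists_E_le [Nonempty X] (f : X → ℝ) : ∃ x, E f ≤ f x := by
  by_contra! h
  have := Fintype.ofFinite X
  obtain ⟨x0, hx0⟩ := Finite.exists_max f
  have := E_le_const hx0
  linarith [h x0]

theorem exists_of_E_pos {P : X → Prop} (h : 0 < E fun x => ind (P x)) : ∃ x, P x := by
  by_contra! hn
  have : (fun x => ind (P x)) = fun x => (0 : ℝ) * 0 := by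
    ext x; simp [ind, hn x]
  rw [this, E_mul] at h
  simp at h

/-- one point carries its share -/
theorem le_card_mul_E {f : X → ℝ} (h : ∀ x, 0 ≤ f x) (x : X) : f x ≤ Nat.card X * E f := by
  have := Fintype.ofFinite X
  have : Nonempty X := ⟨x⟩
  rw [E_eq, Nat.card_eq_fintype_card, mul_div_cancel₀]
  · exact Finset.single_le_sum (fun i _ => h i) (Finset.mem_univ x)
  · simp

theorem markov [Nonempty X] {f : X → ℝ} {a : ℝ} (h1 : ∀ x, f x ≤ 1) (ha : 0 ≤ a) (h : a ≤ E f) :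
    a / 2 ≤ E fun x => ind (a / 2 ≤ f x) := by
  have : E f ≤ E fun x => (ind (a / 2 ≤ f x) + a / 2) := by
    apply E_mono
    intro x
    by_cases hx : a / 2 ≤ f x
    · rw [ind_true hx]; linarith [h1 x]
    · rw [ind_false hx]; linarith
  rw [E_add, E_const] at this
  linarith

theorem pigeon {V : Type*} [Finite V] {G : X → Prop} {P : V → X → Prop} {a : ℝ} (ha : 0 < a)
    (hG : a ≤ E fun x => ind (G x)) (h : ∀ x, G x → ∃ v, P v x) :
    ∃ v, a / Nat.card V ≤ E fun x => ind (P v x) := by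
  have := Fintype.ofFinite V
  by_contra! hn
  have h1 : (E fun x => ind (G x)) ≤ E fun x => ∑ v, ind (P v x) := by
    apply E_mono
    intro x
    by_cases hx : G x
    · obtain ⟨v, hv⟩ := h x hx
      rw [ind_true hx, ← ind_true hv]
      exact Finset.single_le_sum (f := fun v => ind (P v x)) (fun i _ => ind_nonneg _)
        (Finset.mem_univ v)
    · rw [ind_false hx]
      exact Finset.sum_nonneg fun i _ => ind_nonneg _
  rw [E_sum] at h1
  obtain ⟨x, hx⟩ := exists_of_E_pos (ha.trans_le hG)
  obtain ⟨v0, -⟩ := h x hx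
  have : Nonempty V := ⟨v0⟩
  have h2 : ∑ v, (E fun x => ind (P v x)) < ∑ v : V, a / Nat.card V :=
    Finset.sum_lt_sum_of_nonempty Finset.univ_nonempty fun v _ => hn v
  rw [Finset.sum_const, Finset.card_univ, nsmul_eq_mul, Nat.card_eq_fintype_card,
    mul_div_cancel₀ _ (by simp)] at h2
  linarith

end

theorem E_sumArrow {ι κ α : Type*} [Finite ι] [Finite κ] [Finite α] (f : (ι ⊕ κ → α) → ℝ) :
    E f = E fun x : ι → α => E fun y : κ → α => f (Sum.elim x y) := by
  rw [← E_equiv (Equiv.sumArrowEquivProdArrow ι κ α).symm, E_prod]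
  rfl

/-- density -/
noncomputable def d {X : Type*} [Finite X] (A : Set X) : ℝ := E fun x => ind (x ∈ A)

theorem d_nonneg {X : Type*} [Finite X] (A : Set X) : 0 ≤ d A := E_nonneg fun _ => ind_nonneg _
theorem d_le_one {X : Type*} [Finite X] [Nonempty X] (A : Set X) : d A ≤ 1 :=
  E_le_const fun _ => ind_le_one _

/-! ### Subspaces -/

/-- composition of subspaces -/
def comp {η κ α ι : Type*} (V : Subspace η α ι) (W : Subspace κ α η) : Subspace κ α ι where
  idxFun i := (V.idxFun i).elim Sum.inl W.idxFun
  proper e := by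
    obtain ⟨j, hj⟩ := W.proper e
    obtain ⟨i, hi⟩ := V.proper j
    exact ⟨i, by simp [hi, hj]⟩

theorem comp_apply {η κ α ι : Type*} (V : Subspace η α ι) (W : Subspace κ α η) (x : κ → α) :
    comp V W x = V (W x) := by
  ext i
  simp only [Subspace.apply_def, comp]
  rcases V.idxFun i with a | j <;> simp [Subspace.apply_def]

instance {η α ι : Type*} [Finite η] [Finite α] [Finite ι] : Finite (Subspace η α ι) :=
  Finite.of_injective Subspace.idxFun fun V W h => by cases V; cases W; simpa using h

/-- renaming of the coordinates -/
def reindexSub {η α ι : Type*} (e : ι ≃ η) : Subspace η α ι where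
  idxFun i := Sum.inr (e i)
  proper j := ⟨e.symm j, by simp⟩

theorem reindexSub_apply {η α ι : Type*} (e : ι ≃ η) (x : η → α) : reindexSub e x = fun i => x (e i) := by
  ext i; simp [Subspace.apply_def, reindexSub]

/-- product with a fixed point on the left -/
def fixL {η α ι κ : Type*} (x : ι → α) (V : Subspace η α κ) : Subspace η α (ι ⊕ κ) where
  idxFun := Sum.elim (fun i => Sum.inl (x i)) V.idxFun
  proper e := by
    obtain ⟨j, hj⟩ := V.proper e
    exact ⟨Sum.inr j, by simpa using hj⟩

theorem fixL_apply {η α ι κ : Type*} (x : ι → α) (V : Subspace η α κ) (z : η → α) :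
    fixL x V z = Sum.elim x (V z) := by
  ext (i | i) <;> simp [Subspace.apply_def, fixL]

/-- product with a fixed point on the right -/
def fixR {η α ι κ : Type*} (V : Subspace η α ι) (y : κ → α) : Subspace η α (ι ⊕ κ) where
  idxFun := Sum.elim V.idxFun (fun i => Sum.inl (y i))
  proper e := by
    obtain ⟨j, hj⟩ := V.proper e
    exact ⟨Sum.inl j, by simpa using hj⟩

theorem fixR_apply {η α ι κ : Type*} (V : Subspace η α ι) (y : κ → α) (z : η → α) :
    fixR V y z = Sum.elim (V z) y := by
  ext (i | i) <;> simp [Subspace.apply_def, fixR]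

/-- fill in the wildcards -/
def fill {ι α : Type*} (a : α) (w : ι → Option α) : ι → α := fun j => (w j).getD a

/-- `A` contains a combinatorial line -/
def HasLine {ι α : Type*} (A : Set (ι → α)) : Prop :=
  ∃ w : ι → Option α, (∃ j, w j = none) ∧ ∀ a, fill a w ∈ A

theorem HasLine.of_sub {η ι α : Type*} {A : Set (ι → α)} (V : Subspace η α ι)
    (h : HasLine {x | V x ∈ A}) : HasLine A := by
  obtain ⟨w, ⟨j, hj⟩, h⟩ := h
  obtain ⟨i, hi⟩ := V.proper j
  refine ⟨fun i => (V.idxFun i).elim some w, ⟨i, by simp [hi, hj]⟩, fun a => ?_⟩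
  have h1 := h a
  rw [Set.mem_ofPred_eq] at h1
  convert h1 using 1
  ext i
  simp only [fill, Subspace.apply_def]
  rcases V.idxFun i with a | j <;> simp [fill]

/-- The density Hales-Jewett theorem for the alphabet `α` and density `δ` -/
def DHJδ (α : Type) [Finite α] (δ : ℝ) : Prop :=
  ∃ (ι : Type) (_ : Finite ι), ∀ A : Set (ι → α), δ ≤ d A → HasLine A

/-- The density Hales-Jewett theorem for the alphabet `α` -/
def DHJ (α : Type) [Finite α] : Prop := ∀ δ : ℝ, 0 < δ → DHJδ α δ

/-- Multidimensional version. -/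
def MDHJ (α : Type) [Finite α] (η : Type) : Prop := ∀ δ : ℝ, 0 < δ →
  ∃ (ι : Type) (_ : Finite ι), ∀ A : Set (ι → α), δ ≤ d A → ∃ V : Subspace η α ι, ∀ x, V x ∈ A

/-- add a line to a subspace -/
def addLine {η α ι κ : Type*} (w : ι → Option α) (hw : ∃ j, w j = none) (V : Subspace η α κ) :
    Subspace (Option η) α (ι ⊕ κ) where
  idxFun := Sum.elim (fun i => (w i).elim (Sum.inr none) Sum.inl)
    (fun j => (V.idxFun j).elim Sum.inl (fun e => Sum.inr (some e)))
  proper e := by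
    rcases e with _ | e
    · obtain ⟨j, hj⟩ := hw
      exact ⟨Sum.inl j, by simp [hj]⟩
    · obtain ⟨j, hj⟩ := V.proper e
      exact ⟨Sum.inr j, by simp [hj]⟩

theorem addLine_apply {η α ι κ : Type*} (w : ι → Option α) (hw : ∃ j, w j = none)
    (V : Subspace η α κ) (x : Option η → α) :
    addLine w hw V x = Sum.elim (fill (x none) w) (V fun e => x (some e)) := by
  ext (i | i)
  · simp only [Subspace.apply_def, addLine, fill, Sum.elim_inl]
    rcases w i with _ | a <;> simp
  · simp only [Subspace.apply_def, addLine, Sum.elim_inr]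
    rcases V.idxFun i with _ | a <;> simp

theorem mdhj_of_dhj (α : Type) [Finite α] [Nonempty α] (h : DHJ α) (η : Type) [Finite η] :
    MDHJ α η := by
  induction η using Finite.induction_empty_option with
  | of_equiv e ih =>
    intro δ hδ
    obtain ⟨ι, hι, H⟩ := ih δ hδ
    refine ⟨ι, hι, fun A hA => ?_⟩
    obtain ⟨V, hV⟩ := H A hA
    exact ⟨comp V (reindexSub e), fun x => by rw [comp_apply]; exact hV _⟩
  | h_empty =>
    intro δ hδ
    refine ⟨PEmpty, inferInstance, fun A hA => ?_⟩
    obtain ⟨x, hx⟩ := exists_of_E_pos (hδ.trans_le hA)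
    refine ⟨⟨fun i => i.elim, fun e => e.elim⟩, fun y => ?_⟩
    convert hx
    ext i
    exact i.elim
  | h_option ih =>
    rename_i η _
    intro δ hδ
    obtain ⟨ι, hι, H⟩ := h (δ / 2) (by positivity)
    have hc : 0 < δ / 2 / Nat.card (ι → Option α) := by
      have : 0 < Nat.card (ι → Option α) := Nat.card_pos
      positivity
    obtain ⟨κ, hκ, K⟩ := ih _ hc
    refine ⟨ι ⊕ κ, inferInstance, fun A hA => ?_⟩
    have h1 : δ ≤ E fun y : κ → α => d {x : ι → α | Sum.elim x y ∈ A} := by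
      refine hA.trans (le_of_eq ?_)
      unfold d
      rw [E_sumArrow, E_comm]
      rfl
    have h2 := markov (fun y => d_le_one _) hδ.le h1
    obtain ⟨w, hw⟩ := pigeon
      (P := fun (w : ι → Option α) y => (∃ j, w j = none) ∧ ∀ a, Sum.elim (fill a w) y ∈ A)
      (by positivity) h2 (fun y hy => H _ hy)
    obtain ⟨V, hV⟩ := K {y | (∃ j, w j = none) ∧ ∀ a, Sum.elim (fill a w) y ∈ A} hw
    obtain ⟨y0⟩ : Nonempty (η → α) := inferInstance
    refine ⟨addLine w (hV y0).1 V, fun x => ?_⟩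
    rw [addLine_apply]
    exact (hV _).2 _


end Szem

open Combinatorics
namespace Szem

theorem E_range {X Z : Type*} [Finite X] [Finite Z] [Nonempty Z] (e : Z → X)
    (he : Function.Injective e) (f : X → ℝ) :
    (E fun x => f x * ind (x ∈ Set.range e)) =
      ((Nat.card Z : ℝ) / Nat.card X) * E fun z => f (e z) := by
  have := Fintype.ofFinite X
  have := Fintype.ofFinite Z
  simp only [E_eq, Nat.card_eq_fintype_card]
  have h : ∑ z, f (e z) = ∑ x, f x * ind (x ∈ Set.range e) := by
    apply Fintype.sum_of_injective e he
    · intro x hx; rw [ind_false hx, mul_zero]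
    · intro z; rw [ind_true ⟨z, rfl⟩, mul_one]
  rw [h]
  have : (Fintype.card Z : ℝ) ≠ 0 := by simp
  field_simp

theorem card_ratio_pos (X Z : Type*) [Finite X] [Finite Z] [Nonempty X] [Nonempty Z] :
    0 < ((Nat.card Z : ℝ) / Nat.card X) := by
  have h1 : 0 < Nat.card X := Nat.card_pos
  have h2 : 0 < Nat.card Z := Nat.card_pos
  positivity

theorem card_ratio_le {X Z : Type*} [Finite X] [Nonempty X] (e : Z → X)
    (he : Function.Injective e) : ((Nat.card Z : ℝ) / Nat.card X) ≤ 1 := by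
  have h1 : 0 < Nat.card X := Nat.card_pos
  rw [div_le_one (by positivity)]
  exact_mod_cast Nat.card_le_card_of_injective e he

theorem sub_injective {η α ι : Type*} (V : Subspace η α ι) :
    Function.Injective (fun x => V x) := by
  intro x y h
  ext e
  obtain ⟨i, hi⟩ := V.proper e
  have := congrFun h i
  simpa [Subspace.apply_def, hi] using this

/-- replace `none` by `some i` -/
def sf {ι α : Type*} (i : α) (x : ι → Option α) : ι → Option α := fun j => some ((x j).getD i)

/-- insensitivity to exchanging `i` and `none` -/
def Ins {ι α : Type*} (i : α) (D : Set (ι → Option α)) : Prop := ∀ x, x ∈ D ↔ sf i x ∈ D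

theorem Ins.compl {ι α : Type*} {i : α} {D : Set (ι → Option α)} (h : Ins i D) : Ins i Dᶜ :=
  fun x => not_congr (h x)

theorem sf_sub {ι η α : Type*} (i : α) (V : Subspace η (Option α) ι) (x : η → Option α) :
    sf i (V x) = sf i (V (sf i x)) := by
  ext1 j
  simp only [sf, Subspace.apply_def]
  rcases V.idxFun j with a | e <;> simp [sf]

theorem Ins.sub {ι η α : Type*} {i : α} {D : Set (ι → Option α)} (h : Ins i D)
    (V : Subspace η (Option α) ι) : Ins i {x | V x ∈ D} := by
  intro x
  simp only [Set.mem_ofPred_eq]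
  rw [h, h (V (sf i x)), sf_sub]

theorem sf_elim {ι κ α : Type*} (i : α) (x : ι → Option α) (y : κ → Option α) :
    sf i (Sum.elim x y) = Sum.elim (sf i x) (sf i y) := by
  ext1 (j | j) <;> simp [sf]

theorem sf_sf {ι α : Type*} (i : α) (x : ι → Option α) : sf i (sf i x) = sf i x := by
  ext1 j; simp [sf]

theorem sf_some {ι α : Type*} (i : α) (x : ι → α) :
    sf i (fun j => some (x j)) = fun j => some (x j) := by
  ext1 j; simp [sf]

theorem Ins.left {ι κ α : Type*} {i : α} {D : Set (ι ⊕ κ → Option α)} (h : Ins i D)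
    (y : κ → Option α) : Ins i {x | Sum.elim x y ∈ D} := by
  intro x
  simp only [Set.mem_ofPred_eq]
  rw [h, h (Sum.elim (sf i x) y), sf_elim, sf_elim, sf_sf]

theorem Ins.right {ι κ α : Type*} {i : α} {D : Set (ι ⊕ κ → Option α)} (h : Ins i D)
    (x : ι → Option α) : Ins i {y | Sum.elim x y ∈ D} := by
  intro y
  simp only [Set.mem_ofPred_eq]
  rw [h, h (Sum.elim x (sf i y)), sf_elim, sf_elim, sf_sf]

theorem Ins.left_eq {ι κ α : Type*} {i : α} {D : Set (ι ⊕ κ → Option α)} (h : Ins i D)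
    (y : κ → Option α) : {x | Sum.elim x y ∈ D} = {x | Sum.elim x (sf i y) ∈ D} := by
  ext x
  simp only [Set.mem_ofPred_eq]
  rw [h, h (Sum.elim x (sf i y)), sf_elim, sf_elim, sf_sf]

/-- extend the alphabet -/
def ext {η α ι : Type*} (V : Subspace η α ι) : Subspace η (Option α) ι where
  idxFun j := (V.idxFun j).elim (fun a => Sum.inl (some a)) Sum.inr
  proper e := by
    obtain ⟨j, hj⟩ := V.proper e
    exact ⟨j, by simp [hj]⟩

theorem sf_ext {η α ι : Type*} (V : Subspace η α ι) (i : α) (x : η → Option α) :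
    sf i (ext V x) = fun j => some (V (fill i x) j) := by
  ext1 j
  simp only [sf, Subspace.apply_def, ext]
  rcases V.idxFun j with a | e <;> simp [fill]

/-- DHJ for insensitive sets -/
def InsDHJ (α : Type) [Finite α] (i : α) (η : Type) : Prop := ∀ β : ℝ, 0 < β →
  ∃ (ι : Type) (_ : Finite ι), ∀ D : Set (ι → Option α), Ins i D → β ≤ d D →
    ∃ V : Subspace η (Option α) ι, ∀ x, V x ∈ D

theorem insDHJ (α : Type) [Finite α] (i : α) (η : Type) [Finite η] (h : MDHJ α η) :
    InsDHJ α i η := by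
  intro β hβ
  have : Nonempty α := ⟨i⟩
  obtain ⟨κ, hκ, H⟩ := h (β / 2) (by positivity)
  let em : (κ → α) → (κ → Option α) := fun z j => some (z j)
  have hem : Function.Injective em := by
    intro x y hxy
    ext j
    simpa [em] using congrFun hxy j
  set p : ℝ := (Nat.card (κ → α) : ℝ) / Nat.card (κ → Option α) with hp
  have hp0 : 0 < p := card_ratio_pos _ _
  have hp1 : p ≤ 1 := card_ratio_le em hem
  have claim : ∀ s : ℕ, ∃ (ι : Type) (_ : Finite ι), ∀ D : Set (ι → Option α), Ins i D →
      (¬ ∃ V : Subspace η (Option α) ι, ∀ x, V x ∈ D) → d D ≤ β / 2 + (1 - p) ^ s := by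
    intro s
    induction s with
    | zero =>
      refine ⟨PEmpty, inferInstance, fun D _ _ => ?_⟩
      have := d_le_one D
      simp only [pow_zero]
      linarith
    | succ s ih =>
      obtain ⟨ι, hι, K⟩ := ih
      refine ⟨κ ⊕ ι, inferInstance, fun D hD hV => ?_⟩
      have e1 : d D = E fun x : κ → Option α => d {y : ι → Option α | Sum.elim x y ∈ D} := by
        unfold d
        rw [E_sumArrow]
        rfl
      have hx : ∀ x : κ → Option α, d {y : ι → Option α | Sum.elim x y ∈ D} ≤
          β / 2 + (1 - p) ^ s := by
        intro x
        apply K _ (hD.right x)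
        rintro ⟨V, hV'⟩
        exact hV ⟨fixL x V, fun z => by rw [fixL_apply]; exact hV' z⟩
      have hy : ∀ y : ι → Option α, d {z : κ → α | Sum.elim (em z) y ∈ D} ≤ β / 2 := by
        intro y
        by_contra! hlt
        obtain ⟨V, hV'⟩ := H _ hlt.le
        refine hV ⟨fixR (ext V) y, fun z => ?_⟩
        rw [fixR_apply]
        have := (hD.left y) (ext V z)
        simp only [Set.mem_ofPred_eq] at this
        rw [this, sf_ext]
        exact hV' _
      have hz : (E fun z : κ → α => d {y : ι → Option α | Sum.elim (em z) y ∈ D}) ≤ β / 2 := by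
        unfold d
        rw [E_comm]
        exact E_le_const hy
      have e2 : d D ≤ E fun x : κ → Option α =>
          (d {y : ι → Option α | Sum.elim x y ∈ D} * ind (x ∈ Set.range em) +
            (β / 2 + (1 - p) ^ s) * (1 - 1 * ind (x ∈ Set.range em))) := by
        rw [e1]
        apply E_mono
        intro x
        by_cases hxr : x ∈ Set.range em
        · rw [ind_true hxr]; linarith
        · rw [ind_false hxr]; linarith [hx x]
      rw [E_add, E_range em hem, E_mul, E_sub, E_range em hem, E_const, E_const] at e2
      rw [← hp] at e2
      have := mul_le_mul_of_nonneg_left hz hp0.le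
      rw [pow_succ]
      linarith
  obtain ⟨s, hs⟩ := exists_pow_lt_of_lt_one (show 0 < β / 2 by positivity)
    (show 1 - p < 1 by linarith)
  obtain ⟨ι, hι, K⟩ := claim s
  refine ⟨ι, hι, fun D hD hd => ?_⟩
  by_contra hV
  have := K D hD hV
  linarith

theorem q_single (α : Type) [Finite α] (i : α) (η : Type) [Finite η] (h : InsDHJ α i η)
    (β : ℝ) (hβ : 0 < β) : ∃ (ι : Type) (_ : Finite ι), ∀ D : Set (ι → Option α), Ins i D →
      ∀ f : (ι → Option α) → ℝ, (∀ x, f x ≤ 1) → β ≤ E (fun x => f x * ind (x ∈ D)) →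
        ∃ V : Subspace η (Option α) ι, β / 2 ≤ E fun z => f (V z) := by
  set b : ℝ := min (β / 8) 1 with hb
  have hb0 : 0 < b := by positivity
  have hb1 : b ≤ 1 := min_le_right _ _
  have hb8 : b ≤ β / 8 := min_le_left _ _
  obtain ⟨κ, hκ, H⟩ := h b hb0
  obtain ⟨V0, -⟩ := H Set.univ (fun x => by simp) (by
    have : d (Set.univ : Set (κ → Option α)) = 1 := by
      unfold d
      simp only [Set.mem_univ, ind_true]
      exact E_const 1
    rw [this]; exact hb1)
  set c : ℝ := (Nat.card (η → Option α) : ℝ) / Nat.card (κ → Option α) with hc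
  have hc0 : 0 < c := card_ratio_pos _ _
  have hc1 : c ≤ 1 := card_ratio_le _ (sub_injective V0)
  have hR : ∀ S : Set (κ → Option α), ∃ R : Set (κ → Option α), R ⊆ S ∧
      ((Ins i S ∧ b ≤ d S) → ∃ V : Subspace η (Option α) κ, R = Set.range (fun z => V z)) ∧
      (¬ (Ins i S ∧ b ≤ d S) → R = ∅) := by
    intro S
    by_cases hS : Ins i S ∧ b ≤ d S
    · obtain ⟨V, hV⟩ := H S hS.1 hS.2
      refine ⟨Set.range (fun z => V z), ?_, fun _ => ⟨V, rfl⟩, fun h => absurd hS h⟩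
      rintro _ ⟨z, rfl⟩
      exact hV z
    · exact ⟨∅, by simp, fun h => absurd h hS, fun _ => rfl⟩
  choose R hR1 hR2 hR3 using hR
  have claim : ∀ T : ℕ, ∃ (ι : Type) (_ : Finite ι), ∀ D : Set (ι → Option α), Ins i D →
      ∀ g : (ι → Option α) → ℝ, (∀ x, g x ≤ 1) →
      (∀ V : Subspace η (Option α) ι, (∀ x, V x ∈ D) → (E fun z => g (V z)) ≤ 0) →
      E (fun x => g x * ind (x ∈ D)) ≤ b + (1 - c) ^ T * (d D - b) := by
    intro T
    induction T with
    | zero =>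
      refine ⟨PEmpty, inferInstance, fun D _ g hg _ => ?_⟩
      have : E (fun x => g x * ind (x ∈ D)) ≤ d D := by
        apply E_mono
        intro x
        have := mul_le_mul_of_nonneg_right (hg x) (ind_nonneg (x ∈ D))
        linarith
      simp only [pow_zero]
      linarith
    | succ T ih =>
      obtain ⟨ι, hι, K⟩ := ih
      refine ⟨κ ⊕ ι, inferInstance, fun D hD g hg hV => ?_⟩
      let S : (ι → Option α) → Set (κ → Option α) := fun y => {x | Sum.elim x y ∈ D}
      have hS : ∀ y, Ins i (S y) := fun y => hD.left y
      have hSs : ∀ y, S y = S (sf i y) := fun y => hD.left_eq y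
      have e1 : E (fun x => g x * ind (x ∈ D)) =
          (E fun y => E fun x => g (Sum.elim x y) * ind (x ∈ R (S y))) +
          E fun x => E fun y => g (Sum.elim x y) * ind (y ∈ {y | x ∈ S y \ R (S y)}) := by
        rw [E_sumArrow, E_comm, E_comm (X := κ → Option α), ← E_add]
        congr 1
        ext y
        rw [← E_add]
        congr 1
        ext x
        have hh := @hR1 (S y) x
        have : (Sum.elim x y ∈ D) = (x ∈ S y) := rfl
        rw [this]
        simp only [Set.mem_ofPred_eq, Set.mem_sdiff]
        by_cases h1 : x ∈ S y <;> by_cases h2 : x ∈ R (S y) <;> simp [ind, h1, h2]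
        exact absurd (hh h2) h1
      have e2 : (E fun y => E fun x => g (Sum.elim x y) * ind (x ∈ R (S y))) ≤ 0 := by
        apply E_le_const
        intro y
        by_cases hy : b ≤ d (S y)
        · obtain ⟨V, hVR⟩ := hR2 (S y) ⟨hS y, hy⟩
          rw [hVR, E_range _ (sub_injective V) (fun x => g (Sum.elim x y))]
          apply mul_nonpos_of_nonneg_of_nonpos hc0.le
          have := hV (fixR V y) (fun z => by
            rw [fixR_apply]
            apply hR1 (S y)
            rw [hVR]
            exact ⟨z, rfl⟩)
          simpa only [fixR_apply] using this
        · rw [hR3 (S y) (fun h => hy h.2)]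
          apply E_le_const
          intro x
          rw [ind_false (by simp), mul_zero]
      have e3 : ∀ x, (E fun y => g (Sum.elim x y) * ind (y ∈ {y | x ∈ S y \ R (S y)})) ≤
          b + (1 - c) ^ T * (d {y | x ∈ S y \ R (S y)} - b) := by
        intro x
        apply K _ _ (fun y => g (Sum.elim x y)) (fun y => hg _)
        · intro V hV'
          have := hV (fixL x V) (fun z => by
            rw [fixL_apply]
            exact (hV' z).1)
          simpa only [fixL_apply] using this
        · intro y
          simp only [Set.mem_ofPred_eq]
          rw [hSs y]
      have e4 := E_mono e3
      rw [E_add, E_mul, E_sub, E_const] at e4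
      have e5 : (E fun x => d {y | x ∈ S y \ R (S y)}) = E fun y => d (S y \ R (S y)) := by
        unfold d
        rw [E_comm]
        rfl
      have e6 : ∀ y, d (S y \ R (S y)) ≤ (1 - c) * d (S y) + c * b := by
        intro y
        by_cases hy : b ≤ d (S y)
        · obtain ⟨V, hVR⟩ := hR2 (S y) ⟨hS y, hy⟩
          have : d (S y \ R (S y)) = d (S y) - E fun x => 1 * ind (x ∈ R (S y)) := by
            unfold d
            rw [← E_sub]
            congr 1
            ext x
            have hh := @hR1 (S y) x
            by_cases h1 : x ∈ S y <;> by_cases h2 : x ∈ R (S y) <;> simp [ind, h1, h2]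
            exact absurd (hh h2) h1
          rw [this, hVR, E_range _ (sub_injective V) (fun x => 1), E_const, ← hc]
          have := d_le_one (S y)
          nlinarith
        · have : d (S y \ R (S y)) ≤ d (S y) := E_mono fun x => ind_mono fun h => h.1
          nlinarith
      have e7 := E_mono e6
      rw [E_add, E_mul, E_const] at e7
      have e8 : (E fun y => d (S y)) = d D := by
        unfold d
        rw [E_sumArrow, E_comm]
        rfl
      rw [e8, ← e5] at e7
      have e9 : 0 ≤ (1 - c) ^ T := pow_nonneg (by linarith) _
      have e10 := mul_le_mul_of_nonneg_left e7 e9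
      rw [e1, pow_succ]
      nlinarith
  obtain ⟨T, hT⟩ := exists_pow_lt_of_lt_one (show 0 < β / 8 by positivity)
    (show 1 - c < 1 by linarith)
  obtain ⟨ι, hι, K⟩ := claim T
  refine ⟨ι, hι, fun D hD f hf hE => ?_⟩
  by_contra! hV
  have h1 := K D hD (fun x => f x - β / 2) (fun x => by linarith [hf x]) (fun V _ => by
    rw [E_sub, E_const]; linarith [hV V])
  have h2 : E (fun x => (f x - β / 2) * ind (x ∈ D)) =
      E (fun x => f x * ind (x ∈ D)) - β / 2 * d D := by
    unfold d
    rw [← E_mul, ← E_sub]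
    congr 1
    ext x
    ring
  have h3 : 0 ≤ (1 - c) ^ T := pow_nonneg (by linarith) _
  have h4 := d_le_one D
  have h5 := d_nonneg D
  rw [h2] at h1
  nlinarith

theorem q_multi (α : Type) [Finite α]
    (h : ∀ (i : α) (η : Type) [Finite η], InsDHJ α i η) (S : Finset α) :
    ∀ (η : Type) [Finite η] (β : ℝ), 0 < β → ∃ (ι : Type) (_ : Finite ι),
      ∀ D : α → Set (ι → Option α), (∀ i, Ins i (D i)) →
      ∀ f : (ι → Option α) → ℝ, (∀ x, f x ≤ 1) → β ≤ E (fun x => f x * ind (∀ i ∈ S, x ∈ D i)) →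
        ∃ V : Subspace η (Option α) ι, 0 < E fun z => f (V z) := by
  classical
  induction S using Finset.induction_on with
  | empty =>
    intro η _ β hβ
    refine ⟨η, inferInstance, fun D _ f hf hE => ⟨reindexSub (Equiv.refl η), ?_⟩⟩
    simp only [Finset.notMem_empty, false_imp_iff, implies_true, ind_true, mul_one] at hE
    simp only [reindexSub_apply, Equiv.refl_apply]
    linarith
  | insert i S hi ih =>
    intro η _ β hβ
    obtain ⟨κ, hκ, K⟩ := ih η (β / 2) (by positivity)
    obtain ⟨ι, hι, L⟩ := q_single α i κ (h i κ) β hβ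
    refine ⟨ι, hι, fun D hD f hf hE => ?_⟩
    obtain ⟨V, hV⟩ := L (D i) (hD i) (fun x => f x * ind (∀ i ∈ S, x ∈ D i)) (fun x => by
      by_cases hx : ∀ i ∈ S, x ∈ D i
      · rw [ind_true hx, mul_one]; exact hf x
      · rw [ind_false hx, mul_zero]; norm_num) (by
      refine hE.trans (le_of_eq ?_)
      congr 1
      ext x
      rw [mul_assoc, ← ind_and]
      congr 2
      simp only [Finset.mem_insert, forall_eq_or_imp, and_comm])
    obtain ⟨W, hW⟩ := K (fun j => {x | V x ∈ D j}) (fun j => (hD j).sub V) (fun x => f (V x))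
      (fun x => hf _) hV
    exact ⟨comp V W, by simpa only [comp_apply] using hW⟩

end Szem

open Combinatorics
namespace Szem

theorem ext_comp {η κ α ι : Type*} (V : Subspace η α ι) (W : Subspace κ α η) (x : κ → Option α) :
    ext (comp V W) x = ext V (ext W x) := by
  ext1 i
  simp only [Subspace.apply_def, comp, ext]
  rcases V.idxFun i with a | j <;> simp [Subspace.apply_def]

/-- The Ramsey-theoretic input. -/
def GR (α H M : Type) : Prop := ∀ (L' : Type) [Finite L'], ∃ (L : Type) (_ : Finite L),
  ∀ big : (L → Option α) → Prop,
    (∃ U : Subspace H (Option α) L, (∃ j, U.idxFun j = Sum.inl none) ∧ ∀ u, big (U u)) ∨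
    ∃ W : Subspace (M ⊕ L') α L, ∀ w : M ⊕ L' → Option α, (∃ m, w (Sum.inl m) = none) →
      ¬ big (ext W w)

/-- auxiliary subspace, small case -/
def auxB {α H M L' K : Type} (c0 : α) (B : Subspace (L' ⊕ H) (Option α) K) :
    Subspace (Option M ⊕ L') α (M ⊕ (Unit ⊕ K)) where
  idxFun := Sum.elim (fun m => Sum.inr (Sum.inl (some m)))
    (Sum.elim (fun _ => Sum.inr (Sum.inl none))
      (fun k => (B.idxFun k).elim (fun o => o.elim (Sum.inr (Sum.inl none)) Sum.inl)
        (Sum.elim (fun l => Sum.inr (Sum.inr l)) (fun _ => Sum.inl c0))))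
  proper e := by
    rcases e with (_ | m) | l
    · exact ⟨Sum.inr (Sum.inl ()), by simp⟩
    · exact ⟨Sum.inl m, by simp⟩
    · obtain ⟨k, hk⟩ := B.proper (Sum.inl l)
      exact ⟨Sum.inr (Sum.inr k), by simp [hk]⟩

theorem auxB_ext {α H M L' K : Type} (c0 : α) (B : Subspace (L' ⊕ H) (Option α) K)
    (w : Option M ⊕ L' → Option α) : ext (auxB c0 B) w =
      Sum.elim (fun m => w (Sum.inl (some m))) (fun j => ext (auxB (M := M) c0 B) w (Sum.inr j)) := by
  ext1 (m | j) <;> simp [Subspace.apply_def, ext, auxB]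

theorem auxB_ext' {α H M L' K : Type} (c0 : α) (B : Subspace (L' ⊕ H) (Option α) K)
    (w : Option M ⊕ L' → Option α) (h : w (Sum.inl none) = none) : ext (auxB c0 B) w =
      Sum.elim (fun m => w (Sum.inl (some m))) (Sum.elim (fun _ => none)
        (B (Sum.elim (fun l => w (Sum.inr l)) (fun _ => some c0)))) := by
  ext1 (m | _ | k)
  · simp [Subspace.apply_def, ext, auxB]
  · simp [Subspace.apply_def, ext, auxB, h]
  · simp only [Subspace.apply_def, ext, auxB, Sum.elim_inr]
    rcases B.idxFun k with (_ | a) | (l | e) <;> simp [h]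

/-- auxiliary subspace, big case -/
def auxU {α H M L' K : Type} (c0 : α) (a : M → α) (B : Subspace (L' ⊕ H) (Option α) K) :
    Subspace H (Option α) (M ⊕ (Unit ⊕ K)) where
  idxFun := Sum.elim (fun m => Sum.inl (some (a m)))
    (Sum.elim (fun _ => Sum.inl none)
      (fun k => (B.idxFun k).elim Sum.inl (Sum.elim (fun _ => Sum.inl (some c0)) Sum.inr)))
  proper e := by
    obtain ⟨k, hk⟩ := B.proper (Sum.inr e)
    exact ⟨Sum.inr (Sum.inr k), by simp [hk]⟩

theorem auxU_apply {α H M L' K : Type} (c0 : α) (a : M → α)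
    (B : Subspace (L' ⊕ H) (Option α) K) (u : H → Option α) : auxU c0 a B u =
      Sum.elim (fun m => some (a m)) (Sum.elim (fun _ => none)
        (B (Sum.elim (fun _ => some c0) u))) := by
  ext1 (m | _ | k)
  · simp [Subspace.apply_def, auxU]
  · simp [Subspace.apply_def, auxU]
  · simp only [Subspace.apply_def, auxU, Sum.elim_inr]
    rcases B.idxFun k with a | (l | e) <;> simp

theorem gr (α H M : Type) [Finite α] [Nonempty α] [Finite H] [Finite M] : GR α H M := by
  induction M using Finite.induction_empty_option with
  | of_equiv e ih =>
    intro L' _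
    obtain ⟨L, hL, K⟩ := ih L'
    refine ⟨L, hL, fun big => ?_⟩
    rcases K big with h | ⟨W, hW⟩
    · exact Or.inl h
    · refine Or.inr ⟨comp W (reindexSub (e.sumCongr (Equiv.refl _))), fun w ⟨m, hm⟩ => ?_⟩
      rw [ext_comp]
      apply hW
      refine ⟨e.symm m, ?_⟩
      simp [Subspace.apply_def, ext, reindexSub, hm]
  | h_empty =>
    intro L' _
    exact ⟨L', inferInstance, fun big => Or.inr
      ⟨reindexSub (Equiv.emptySum PEmpty L').symm, fun w ⟨m, _⟩ => m.elim⟩⟩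
  | h_option ih =>
    rename_i M _
    intro L' _
    obtain ⟨c0⟩ : Nonempty α := inferInstance
    obtain ⟨K, hK, HK⟩ := Subspace.exists_mono_in_high_dimension (Option α) ((M → α) → Prop)
      (L' ⊕ H)
    obtain ⟨L, hL, HL⟩ := ih (Unit ⊕ K)
    refine ⟨L, hL, fun big => ?_⟩
    rcases HL big with h | ⟨W, hW⟩
    · exact Or.inl h
    obtain ⟨B, col, hB⟩ := HK (fun b a => big (ext W
      (Sum.elim (fun m => some (a m)) (Sum.elim (fun _ => none) b))))
    by_cases hcol : ∃ a, col a
    · obtain ⟨a, ha⟩ := hcol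
      left
      refine ⟨comp (ext W) (auxU c0 a B), ?_, fun u => ?_⟩
      · obtain ⟨j, hj⟩ := (ext W).proper (Sum.inr (Sum.inl ()))
        exact ⟨j, by simp [comp, hj, auxU]⟩
      · rw [comp_apply, auxU_apply]
        have := congrFun (hB (Sum.elim (fun _ => some c0) u)) a
        exact this.mpr ha
    · right
      refine ⟨comp W (auxB c0 B), fun w hw => ?_⟩
      rw [ext_comp]
      by_cases hM : ∃ m, w (Sum.inl (some m)) = none
      · obtain ⟨m, hm⟩ := hM
        rw [auxB_ext]
        exact hW _ ⟨m, hm⟩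
      · have hn : w (Sum.inl none) = none := by
          obtain ⟨_ | m, hm⟩ := hw
          · exact hm
          · exact absurd ⟨m, hm⟩ hM
        push Not at hM
        choose a ha using fun m => Option.ne_none_iff_exists'.mp (hM m)
        rw [auxB_ext' c0 B w hn]
        have := congrFun (hB (Sum.elim (fun l => w (Sum.inr l)) (fun _ => some c0))) a
        intro hbig
        refine hcol ⟨a, this.mp ?_⟩
        simpa only [ha] using hbig

theorem regular (α L : Type) [Finite α] [Nonempty α] [Finite L] (δ η : ℝ) (hδ : δ ≤ 1)
    (hη : 0 < η) : ∃ (ι : Type) (_ : Finite ι), ∀ A : Set (ι → α), δ ≤ d A →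
      ∃ (Y : Type) (_ : Finite Y) (_ : Nonempty Y) (Φ : Y → Subspace L α ι),
        ∀ x : L → α, δ - η ≤ E fun y => ind (Φ y x ∈ A) := by
  have hcard : 0 < (Nat.card (L → α) : ℝ) := by exact_mod_cast Nat.card_pos
  set g : ℝ := η / Nat.card (L → α) with hg
  have hg0 : 0 < g := by positivity
  have hcg : Nat.card (L → α) * g = η := by rw [hg]; field_simp
  have claim : ∀ T : ℕ, ∃ (ι : Type) (_ : Finite ι), ∀ A : Set (ι → α), δ ≤ d A →
      1 - T * g ≤ d A →
      ∃ (Y : Type) (_ : Finite Y) (_ : Nonempty Y) (Φ : Y → Subspace L α ι),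
        ∀ x : L → α, δ - η ≤ E fun y => ind (Φ y x ∈ A) := by
    intro T
    induction T with
    | zero =>
      refine ⟨L, inferInstance, fun A hA hA1 => ?_⟩
      refine ⟨Unit, inferInstance, inferInstance, fun _ => reindexSub (Equiv.refl L), fun x => ?_⟩
      rw [E_const, reindexSub_apply]
      have := le_card_mul_E (f := fun x => 1 - ind (x ∈ A))
        (fun x => sub_nonneg.mpr (ind_le_one _)) x
      rw [E_sub, E_const] at this
      have h2 : (1 - E fun x => ind (x ∈ A)) ≤ 0 := by
        simp only [Nat.cast_zero, zero_mul, sub_zero] at hA1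
        unfold d at hA1
        linarith
      have h3 := mul_nonpos_of_nonneg_of_nonpos hcard.le h2
      simp only [Equiv.refl_apply]
      linarith
    | succ T ih =>
      obtain ⟨κ, hκ, K⟩ := ih
      refine ⟨L ⊕ κ, inferInstance, fun A hA hA1 => ?_⟩
      have e1 : (E fun x : L → α => d {y : κ → α | Sum.elim x y ∈ A}) = d A := by
        unfold d
        rw [E_sumArrow]
        rfl
      by_cases hx : ∃ x : L → α, d A + g ≤ d {y : κ → α | Sum.elim x y ∈ A}
      · obtain ⟨x, hx⟩ := hx
        obtain ⟨Y, hY, hY', Φ, hΦ⟩ := K _ (by linarith : δ ≤ d {y : κ → α | Sum.elim x y ∈ A}) (by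
          push_cast at hA1
          linarith)
        refine ⟨Y, hY, hY', fun y => fixL x (Φ y), fun z => ?_⟩
        simp only [fixL_apply]
        exact hΦ z
      · push Not at hx
        refine ⟨κ → α, inferInstance, inferInstance, fun y => fixR (reindexSub (Equiv.refl L)) y,
          fun x => ?_⟩
        simp only [fixR_apply, reindexSub_apply, Equiv.refl_apply]
        have := le_card_mul_E (f := fun x => (d A + g) - d {y : κ → α | Sum.elim x y ∈ A})
          (fun x => by linarith [hx x]) x
        rw [E_sub, E_const, e1, add_sub_cancel_left, hcg] at this
        have h2 : d {y : κ → α | Sum.elim x y ∈ A} = E fun y => ind (Sum.elim x y ∈ A) := rfl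
        linarith
  obtain ⟨T, hT⟩ := exists_nat_gt (1 / g)
  obtain ⟨ι, hι, K⟩ := claim T
  refine ⟨ι, hι, fun A hA => K A hA ?_⟩
  have := d_nonneg A
  rw [div_lt_iff₀ hg0] at hT
  linarith

theorem pattern {α X : Type} [Finite α] [Finite X] (D : α → Set X) (f : X → ℝ) (γ : ℝ)
    (hγ : 0 < γ) (h : γ ≤ E fun u => f u * ind (¬ ∀ i, u ∈ D i)) :
    ∃ s : Set α, γ / Nat.card (Set α) ≤
      E fun u => f u * ind (∀ i, u ∈ {u | u ∈ D i ↔ i ∈ s}) := by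
  classical
  have := Fintype.ofFinite (Set α)
  by_contra! hs
  have hpt : ∀ u, f u * ind (¬ ∀ i, u ∈ D i) = ∑ s : Set α, ind (s ≠ Set.univ) *
      (f u * ind (∀ i, u ∈ {u | u ∈ D i ↔ i ∈ s})) := by
    intro u
    rw [Fintype.sum_eq_single {i | u ∈ D i}]
    · have h1 : ∀ i, u ∈ {v | v ∈ D i ↔ i ∈ {i | u ∈ D i}} := fun i => Iff.rfl
      rw [ind_true h1]
      have h2 : (¬ ∀ i, u ∈ D i) ↔ {i | u ∈ D i} ≠ Set.univ := by
        rw [Ne, Set.eq_univ_iff_forall]; rfl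
      rw [h2]
      ring
    · intro s hs
      have : ¬ ∀ i, u ∈ {u | u ∈ D i ↔ i ∈ s} := by
        intro h
        apply hs
        ext i
        exact (h i).symm
      rw [ind_false this, mul_zero, mul_zero]
  simp only [hpt] at h
  rw [E_sum] at h
  simp only [E_mul] at h
  have hpos : 0 < (Fintype.card (Set α) : ℝ) := by exact_mod_cast Fintype.card_pos
  have h2 : (∑ s : Set α, ind (s ≠ Set.univ) *
      E fun u => (f u * ind (∀ i, u ∈ {u | u ∈ D i ↔ i ∈ s}))) <
      ∑ s : Set α, γ / Nat.card (Set α) := by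
    apply Finset.sum_lt_sum_of_nonempty Finset.univ_nonempty
    intro s _
    by_cases hsu : s ≠ Set.univ
    · rw [ind_true hsu, one_mul]; exact hs s
    · rw [ind_false hsu, zero_mul, Nat.card_eq_fintype_card]; positivity
  rw [Finset.sum_const, Finset.card_univ, nsmul_eq_mul, Nat.card_eq_fintype_card,
    mul_div_cancel₀ _ hpos.ne'] at h2
  linarith

theorem dhj_step (α : Type) [Finite α] [Nonempty α] (h : DHJ α) (δ0 : ℝ) (h0 : 0 < δ0) :
    ∃ γ : ℝ, 0 < γ ∧ ∀ δ, δ0 ≤ δ → δ ≤ 1 → DHJδ (Option α) (δ + γ) → DHJδ (Option α) δ := by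
  obtain ⟨M, hM, HM⟩ := h (δ0 / 2 / 2) (by positivity)
  have hcM : 1 ≤ (Nat.card (M → Option α) : ℝ) := by exact_mod_cast Nat.card_pos
  set θ : ℝ := δ0 / 2 / 2 / Nat.card (M → Option α) with hθ
  have hθ0 : 0 < θ := by positivity
  have hθ1 : θ ≤ δ0 / 2 / 2 := div_le_self (by positivity) hcM
  refine ⟨δ0 * θ / 4, by positivity, fun δ hδ0 hδ1 ⟨κ, hκ, P⟩ => ?_⟩
  set γ : ℝ := δ0 * θ / 4 with hγ
  have hγ0 : 0 < γ := by positivity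
  have hcS : 0 < (Nat.card (Set α) : ℝ) := by exact_mod_cast Nat.card_pos
  have := Fintype.ofFinite α
  obtain ⟨H, hH, HQ⟩ := q_multi α (fun i η _ => insDHJ α i η (mdhj_of_dhj α h η)) Finset.univ κ
    (γ / Nat.card (Set α)) (by positivity)
  obtain ⟨L, hL, HL⟩ := gr α H M PEmpty
  obtain ⟨ι, hι, HR⟩ := regular (Option α) L δ γ hδ1 hγ0
  refine ⟨ι, hι, fun A hA => ?_⟩
  obtain ⟨Y, hY, hY', Φ, hΦ⟩ := HR A hA
  rcases HL (fun w => θ ≤ E fun y => ind (∀ i : α, Φ y (sf i w) ∈ A)) with ⟨U, hU0, hU⟩ | ⟨W, hW⟩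
  · by_contra hline
    have hdisj : ∀ y u, (∀ i, Φ y (sf i (U u)) ∈ A) → Φ y (U u) ∉ A := by
      intro y u hall hu
      apply hline
      apply HasLine.of_sub (Φ y)
      refine ⟨fun j => (U u j).map some, ?_, fun a => ?_⟩
      · obtain ⟨j, hj⟩ := hU0
        exact ⟨j, by simp [Subspace.apply_def, hj]⟩
      · rcases a with _ | i
        · have : fill none (fun j => (U u j).map some) = U u := by
            ext1 j
            simp only [fill]
            rcases U u j with _ | a <;> simp
          rw [this]; exact hu
        · have : fill (some i) (fun j => (U u j).map some) = sf i (U u) := by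
            ext1 j
            simp only [fill, sf]
            rcases U u j with _ | a <;> simp
          rw [this]; exact hall i
    let D : Y → α → Set (H → Option α) := fun y i => {u | Φ y (sf i (U u)) ∈ A}
    have hD : ∀ y i, Ins i (D y i) := by
      intro y i u
      change Φ y (sf i (U u)) ∈ A ↔ Φ y (sf i (U (sf i u))) ∈ A
      rw [← sf_sub]
    let f : Y → (H → Option α) → ℝ := fun y u => ind (Φ y (U u) ∈ A) - (δ + γ)
    have hpt : ∀ y u, f y u * ind (¬ ∀ i, u ∈ D y i) =
        ind (Φ y (U u) ∈ A) - (δ + γ) * (1 - ind (∀ i, u ∈ D y i)) := by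
      intro y u
      simp only [f]
      rw [ind_not]
      by_cases hu : ∀ i, u ∈ D y i
      · rw [ind_true hu, ind_false (hdisj y u hu)]; ring
      · rw [ind_false hu]; ring
    have hE : γ ≤ E fun y => E fun u => f y u * ind (¬ ∀ i, u ∈ D y i) := by
      simp only [hpt, E_sub, E_mul, E_const]
      have h1 : δ - γ ≤ E fun y => E fun u => ind (Φ y (U u) ∈ A) := by
        rw [E_comm]
        exact const_le_E fun u => hΦ _
      have h2 : θ ≤ E fun y => E fun u => ind (∀ i, u ∈ D y i) := by
        rw [E_comm]
        exact const_le_E fun u => hU u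
      have h3 : (δ + γ) * θ ≤ (δ + γ) * E fun y => E fun u => ind (∀ i, u ∈ D y i) :=
        mul_le_mul_of_nonneg_left h2 (by linarith)
      have h4 : δ0 * θ ≤ δ * θ := mul_le_mul_of_nonneg_right hδ0 hθ0.le
      have h5 : 0 < γ * θ := by positivity
      nlinarith
    obtain ⟨y, hy⟩ := exists_E_le (fun y => E fun u => f y u * ind (¬ ∀ i, u ∈ D y i))
    obtain ⟨s, hs⟩ := pattern (D y) (f y) γ hγ0 (hE.trans hy)
    obtain ⟨V, hV⟩ := HQ (fun i => {u | u ∈ D y i ↔ i ∈ s}) (fun i u => by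
        simp only [Set.mem_ofPred_eq]
        rw [hD y i u]) (f y) (fun u => by
        have := ind_le_one (Φ y (U u) ∈ A)
        simp only [f]
        linarith) (by simpa only [Finset.mem_univ, true_imp_iff] using hs)
    simp only [f, E_sub, E_const] at hV
    apply hline
    apply HasLine.of_sub (comp (comp (Φ y) U) V)
    apply P
    simp only [comp_apply]
    unfold d
    simp only [Set.mem_ofPred_eq]
    linarith
  · exfalso
    let pt : (M → α) → (L → Option α) := fun z j => some (W (Sum.elim z PEmpty.elim) j)
    have hγ2 : γ ≤ δ0 / 2 := by
      rw [hγ]; nlinarith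
    have h1 : δ0 / 2 ≤ E fun y => d {z | Φ y (pt z) ∈ A} := by
      unfold d
      rw [E_comm]
      refine const_le_E fun z => ?_
      have := hΦ (pt z)
      simp only [Set.mem_ofPred_eq]
      linarith
    have h2 := markov (fun y => d_le_one _) (by positivity) h1
    obtain ⟨w, hw⟩ := pigeon
      (P := fun (w : M → Option α) y => (∃ j, w j = none) ∧ ∀ a, Φ y (pt (fill a w)) ∈ A)
      (by positivity) h2 (fun y hy => HM _ hy)
    rw [← hθ] at hw
    obtain ⟨y, ⟨j, hj⟩, -⟩ := exists_of_E_pos (hθ0.trans_le hw)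
    refine hW (Sum.elim w PEmpty.elim) ⟨j, hj⟩ (hw.trans (E_mono fun y => ind_mono fun hh i => ?_))
    rw [sf_ext]
    have : fill i (Sum.elim w (PEmpty.elim : PEmpty → Option α)) =
        Sum.elim (fill i w) PEmpty.elim := by
      ext1 (j | j)
      · rfl
      · exact j.elim
    rw [this]
    exact hh.2 i

theorem dhj_option (α : Type) [Finite α] [Nonempty α] (h : DHJ α) : DHJ (Option α) := by
  intro δ0 h0
  obtain ⟨γ, hγ, hs⟩ := dhj_step α h δ0 h0
  have triv : ∀ δ : ℝ, 1 < δ → DHJδ (Option α) δ := fun δ hδ =>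
    ⟨PEmpty, inferInstance, fun A hA => by have := d_le_one A; linarith⟩
  have claim : ∀ n : ℕ, ∀ δ, δ0 ≤ δ → 1 < δ + n * γ → DHJδ (Option α) δ := by
    intro n
    induction n with
    | zero => intro δ _ h1; exact triv δ (by simpa using h1)
    | succ n ih =>
      intro δ hδ h1
      by_cases h2 : δ ≤ 1
      · refine hs δ hδ h2 (ih _ (by linarith) ?_)
        push_cast at h1
        linarith
      · exact triv δ (by linarith)
  obtain ⟨n, hn⟩ := exists_nat_gt (1 / γ)
  rw [div_lt_iff₀ hγ] at hn
  exact claim n δ0 le_rfl (by linarith)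

/-- The density Hales-Jewett theorem. -/
theorem dhj (α : Type) [hf : Finite α] [hn : Nonempty α] : DHJ α := by
  suffices H : ∀ (hf : Finite α), Nonempty α → DHJ α from H hf hn
  clear hn
  induction α using Finite.induction_empty_option with
  | of_equiv e ih =>
    intro hf hn δ hδ
    have := Finite.of_equiv _ e.symm
    obtain ⟨ι, hι, H⟩ := ih this (e.nonempty) δ hδ
    refine ⟨ι, hι, fun A hA => ?_⟩
    obtain ⟨w, ⟨j, hj⟩, hw⟩ := H {x | (fun j => e (x j)) ∈ A} (by
      refine hA.trans (le_of_eq ?_)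
      unfold d
      rw [← E_equiv (Equiv.arrowCongr (Equiv.refl ι) e)]
      rfl)
    refine ⟨fun j => (w j).map e, ⟨j, by simp [hj]⟩, fun a => ?_⟩
    have := hw (e.symm a)
    simp only [Set.mem_ofPred_eq] at this
    convert this using 1
    ext1 j
    simp only [fill]
    rcases w j with _ | b <;> simp
  | h_empty => intro _ ⟨x⟩; exact x.elim
  | h_option ih =>
    rename_i α _
    intro hf hn
    by_cases hα : Nonempty α
    · exact dhj_option α (ih inferInstance hα)
    · have : IsEmpty α := not_nonempty_iff.mp hα
      intro δ hδ
      refine ⟨Unit, inferInstance, fun A hA => ?_⟩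
      obtain ⟨x, hx⟩ := exists_of_E_pos (hδ.trans_le hA)
      exact ⟨fun _ => none, ⟨(), rfl⟩, fun a => by
        rwa [Subsingleton.elim (fill a fun _ => none) x]⟩

end Szem

open Combinatorics
namespace Szem

/-- Szemerédi's theorem. -/
theorem szemeredi (S : Set ℤ) (ε : ℝ) (hε : 0 < ε)
    (hS : ∀ K : ℕ, ∃ (M : ℕ) (F : Finset ℤ), (∀ s ∈ F, s ∈ S) ∧ (∀ s ∈ F, -(M : ℤ) ≤ s ∧ s ≤ M) ∧
      ε * (2 * M + 1 + K) ≤ F.card) (N : ℕ) :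
    ∃ B D : ℤ, 0 < D ∧ ∀ i : ℕ, i < N + 1 → B + i * D ∈ S := by
  classical
  obtain ⟨ι, hι, H⟩ := dhj (Fin (N + 1)) ε hε
  have := Fintype.ofFinite ι
  let φ : (ι → Fin (N + 1)) → ℤ := fun x => ∑ j, ((x j : ℕ) : ℤ)
  have hφ0 : ∀ x, 0 ≤ φ x := fun x => Finset.sum_nonneg fun j _ => by positivity
  set K : ℕ := Fintype.card ι * N with hK
  have hφ1 : ∀ x, φ x ≤ K := by
    intro x
    have : φ x ≤ ∑ j : ι, (N : ℤ) := Finset.sum_le_sum fun j _ => by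
      have := (x j).2
      omega
    simpa [hK] using this
  obtain ⟨M, F, hFS, hFM, hF⟩ := hS K
  let T := Finset.Icc (-(M : ℤ) - K) M
  have hT : T.card = 2 * M + 1 + K := by
    simp only [T, Int.card_Icc]; omega
  have hTne : Nonempty T := by
    have : 0 < T.card := by omega
    exact (Finset.card_pos.mp this).to_subtype
  have hpt : ∀ x, ε ≤ E fun t : T => ind ((t : ℤ) + φ x ∈ S) := by
    intro x
    rw [E_eq, Fintype.card_coe, hT, le_div_iff₀ (by positivity)]
    push_cast
    refine hF.trans ?_
    have h1 : ∑ t : T, ind ((t : ℤ) + φ x ∈ S) = ∑ t ∈ T, ind (t + φ x ∈ S) :=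
      Finset.sum_coe_sort T (fun t => ind (t + φ x ∈ S))
    rw [h1]
    have h2 : (F.card : ℝ) = ∑ t ∈ F.image (fun s => s - φ x), ind (t + φ x ∈ S) := by
      rw [Finset.sum_congr rfl (g := fun _ => (1 : ℝ))]
      · rw [Finset.sum_const, Finset.card_image_of_injective _ (sub_left_injective), nsmul_eq_mul,
          mul_one]
      · intro t ht
        obtain ⟨s, hs, rfl⟩ := Finset.mem_image.mp ht
        exact ind_true (by simpa using hFS s hs)
    rw [h2]
    apply Finset.sum_le_sum_of_subset_of_nonneg
    · intro t ht
      obtain ⟨s, hs, rfl⟩ := Finset.mem_image.mp ht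
      have := hFM s hs
      have := hφ0 x
      have := hφ1 x
      simp only [T, Finset.mem_Icc]
      omega
    · intro t _ _
      exact ind_nonneg _
  have hE : ε ≤ E fun t : T => d {x | (t : ℤ) + φ x ∈ S} := by
    unfold d
    rw [E_comm]
    exact const_le_E hpt
  obtain ⟨t, ht⟩ := exists_E_le (fun t : T => d {x | (t : ℤ) + φ x ∈ S})
  obtain ⟨w, ⟨j, hj⟩, hw⟩ := H _ (hE.trans ht)
  refine ⟨t + ∑ j, ((w j).elim 0 (fun a => ((a : ℕ) : ℤ))), ∑ j, if w j = none then 1 else 0, ?_, ?_⟩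
  · apply Finset.sum_pos'
    · intro i _; split_ifs <;> norm_num
    · exact ⟨j, Finset.mem_univ j, by simp [hj]⟩
  · intro i hi
    have := hw ⟨i, hi⟩
    simp only [Set.mem_ofPred_eq] at this
    convert this using 1
    rw [add_assoc, Finset.mul_sum, ← Finset.sum_add_distrib]
    congr 1
    apply Finset.sum_congr rfl
    intro j _
    simp only [fill]
    rcases w j with _ | a <;> simp

end Szem

theorem stmt11 (Λ : Set ℝ) (h0 : (0 : ℝ) ∈ Λ) (δ : ℝ) (hδ : 0 < δ)
    (hsep : ∀ x ∈ Λ, ∀ y ∈ Λ, ∀ z ∈ Λ, ∀ w ∈ Λ,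
      x - y ≠ z - w → δ ≤ |(x - y) - (z - w)|)
    (hdens : 0 < Filter.limsup
      (fun R : ℕ => (Nat.card ↑(Λ ∩ Set.Icc (-(R : ℝ)) (R : ℝ)) : ℝ) / (2 * R))
      Filter.atTop) :
    ∀ N : ℕ, ∃ a d : ℝ, 0 < d ∧ ∀ i : ℕ, i < N → a + i * d ∈ Λ := by
  classical
  intro N
  obtain ⟨c, hc0, hc⟩ := exists_between hdens
  have hfreq := Filter.frequently_lt_of_lt_limsup
    (Filter.isCoboundedUnder_le_of_le Filter.atTop (x := 0) (fun R => by positivity)) hc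
  let fl : ℝ → ℤ := fun x => ⌊2 * x / δ⌋
  have hfl1 : ∀ x, (fl x : ℝ) * δ ≤ 2 * x := fun x => by
    have := Int.floor_le (2 * x / δ)
    rwa [le_div_iff₀ hδ] at this
  have hfl2 : ∀ x, 2 * x < ((fl x : ℝ) + 1) * δ := fun x => by
    have := Int.lt_floor_add_one (2 * x / δ)
    rwa [div_lt_iff₀ hδ] at this
  have hinj : Set.InjOn fl Λ := by
    intro x hx y hy hxy
    by_contra hne
    have h1 := hsep x hx 0 h0 y hy 0 h0 (by simpa using hne)
    simp only [sub_zero] at h1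
    have a1 := hfl1 x
    have a2 := hfl2 x
    have a3 := hfl1 y
    have a4 := hfl2 y
    rw [hxy] at a1 a2
    have : |x - y| < δ := by rw [abs_lt]; constructor <;> nlinarith
    linarith
  obtain ⟨B, D, hD, hAP⟩ := Szem.szemeredi (fl '' Λ) (c * δ / 4) (by positivity) (by
    intro K
    obtain ⟨R0, hR0⟩ := exists_nat_gt (δ * (5 + K))
    obtain ⟨R, hRc, hR⟩ := (hfreq.and_eventually (Filter.eventually_ge_atTop (R0 + 1))).exists
    have hR' : (R0 : ℝ) + 1 ≤ R := by exact_mod_cast hR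
    have hRpos : (0 : ℝ) < R := by
      have : (0 : ℝ) ≤ R0 := by positivity
      linarith
    rw [lt_div_iff₀ (by positivity)] at hRc
    have hcard : 0 < Nat.card ↑(Λ ∩ Set.Icc (-(R : ℝ)) (R : ℝ)) := by
      have : (0 : ℝ) < Nat.card ↑(Λ ∩ Set.Icc (-(R : ℝ)) (R : ℝ)) :=
        lt_trans (by positivity) hRc
      exact_mod_cast this
    have hfin : (Λ ∩ Set.Icc (-(R : ℝ)) (R : ℝ)).Finite :=
      (Nat.card_pos_iff.mp hcard).2
    have hmem : ∀ s ∈ hfin.toFinset.image fl, ∃ x ∈ Λ, -(R : ℝ) ≤ x ∧ x ≤ R ∧ fl x = s := by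
      intro s hs
      obtain ⟨x, hx, rfl⟩ := Finset.mem_image.mp hs
      rw [Set.Finite.mem_toFinset] at hx
      exact ⟨x, hx.1, hx.2.1, hx.2.2, rfl⟩
    have hceil : 2 * (R : ℝ) / δ ≤ (⌈2 * (R : ℝ) / δ⌉₊ : ℝ) := Nat.le_ceil _
    rw [div_le_iff₀ hδ] at hceil
    refine ⟨⌈2 * (R : ℝ) / δ⌉₊ + 1, hfin.toFinset.image fl, ?_, ?_, ?_⟩
    · intro s hs
      obtain ⟨x, hx, -, -, rfl⟩ := hmem s hs
      exact ⟨x, hx, rfl⟩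
    · intro s hs
      obtain ⟨x, hx, h1, h2, rfl⟩ := hmem s hs
      have a1 := hfl1 x
      have a2 := hfl2 x
      constructor
      · have : (-((⌈2 * (R : ℝ) / δ⌉₊ : ℝ)) ) < (fl x : ℝ) + 1 := by
          by_contra! hh
          have := mul_le_mul_of_nonneg_right hh hδ.le
          nlinarith
        have h3 : (-((⌈2 * (R : ℝ) / δ⌉₊ : ℤ)) ) < fl x + 1 := by exact_mod_cast this
        push_cast at h3 ⊢
        linarith
      · have : (fl x : ℝ) ≤ (⌈2 * (R : ℝ) / δ⌉₊ : ℝ) := by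
          by_contra! hh
          have := mul_lt_mul_of_pos_right hh hδ
          nlinarith
        have h3 : fl x ≤ (⌈2 * (R : ℝ) / δ⌉₊ : ℤ) := by exact_mod_cast this
        push_cast at h3 ⊢
        linarith
    · rw [Finset.card_image_of_injOn (hinj.mono (by
        intro x hx
        rw [Finset.mem_coe, Set.Finite.mem_toFinset] at hx
        exact hx.1)), ← Nat.card_eq_card_finite_toFinset hfin]
      have hlt : (⌈2 * (R : ℝ) / δ⌉₊ : ℝ) < 2 * (R : ℝ) / δ + 1 :=
        Nat.ceil_lt_add_one (by positivity)
      push_cast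
      have h1 : c * δ / 4 * (2 * ((⌈2 * (R : ℝ) / δ⌉₊ : ℝ) + 1) + 1 + K) ≤
          c * δ / 4 * (2 * (2 * (R : ℝ) / δ + 1 + 1) + 1 + K) := by
        gcongr
      have h2 : c * δ / 4 * (2 * (2 * (R : ℝ) / δ + 1 + 1) + 1 + K) =
          c * R + c * (δ * (5 + K)) / 4 := by
        field_simp
        ring
      have h3 : c * (δ * (5 + K)) ≤ c * R := by
        apply mul_le_mul_of_nonneg_left _ hc0.le
        linarith
      have h4 : 0 < c * R := by positivity
      linarith) (N + 1)
  choose! lam hlam hfl using hAP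
  have hkey : ∀ i : ℕ, i < N + 1 → lam (i + 1) - lam i = lam 1 - lam 0 := by
    intro i hi
    by_contra hne
    have h1 := hsep _ (hlam (i + 1) (by omega)) _ (hlam i (by omega)) _ (hlam 1 (by omega)) _
      (hlam 0 (by omega)) hne
    have b1 : (fl (lam (i + 1)) : ℝ) = B + (i + 1) * D := by
      rw [hfl _ (by omega)]; push_cast; ring
    have b2 : (fl (lam i) : ℝ) = B + i * D := by
      rw [hfl _ (by omega)]; push_cast; ring
    have b3 : (fl (lam 1) : ℝ) = B + D := by
      rw [hfl _ (by omega)]; push_cast; ring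
    have b4 : (fl (lam 0) : ℝ) = B := by
      rw [hfl _ (by omega)]; push_cast; ring
    have a1 := hfl1 (lam (i + 1))
    have a2 := hfl2 (lam (i + 1))
    have a3 := hfl1 (lam i)
    have a4 := hfl2 (lam i)
    have a5 := hfl1 (lam 1)
    have a6 := hfl2 (lam 1)
    have a7 := hfl1 (lam 0)
    have a8 := hfl2 (lam 0)
    rw [b1] at a1 a2
    rw [b2] at a3 a4
    rw [b3] at a5 a6
    rw [b4] at a7 a8
    have : |lam (i + 1) - lam i - (lam 1 - lam 0)| < δ := by
      rw [abs_lt]; constructor <;> linarith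
    linarith
  have hform : ∀ i : ℕ, i < N + 2 → lam i = lam 0 + i * (lam 1 - lam 0) := by
    intro i
    induction i with
    | zero => intro _; simp
    | succ i ih =>
      intro hi
      have h1 := ih (by omega)
      have h2 := hkey i (by omega)
      push_cast
      linarith
  refine ⟨lam 0, lam 1 - lam 0, ?_, fun i hi => ?_⟩
  · have b3 : (fl (lam 1) : ℝ) = B + D := by
      rw [hfl _ (by omega)]; push_cast; ring
    have b4 : (fl (lam 0) : ℝ) = B := by
      rw [hfl _ (by omega)]; push_cast; ring
    have a5 := hfl1 (lam 1)
    have a8 := hfl2 (lam 0)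
    rw [b3] at a5
    rw [b4] at a8
    have hD1 : (1 : ℝ) ≤ D := by exact_mod_cast hD
    have : 1 * δ ≤ D * δ := mul_le_mul_of_nonneg_right hD1 hδ.le
    linarith
  · rw [← hform i (by omega)]
    exact hlam i (by omega)
end

section
/- Suppose six roots of unity α₁, ..., α₆ sum to zero and no proper nonempty subset of them sums to zero. Then, after multiplying all of them by a common root of unity (normalizing), they are a permutation of (ρ, ρ², ρ³, ρ⁴, −ω, −ω²), where ρ = e^{2πi/5} and ω = e^{2πi/3}. -/
lemma conj_sum (α : Fin 6 → ℂ) (n a : ℕ) (hn : 0 < n) (hα : ∀ i, α i ^ n = 1)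
    (hsum : ∑ i, α i = 0) (ha : Nat.Coprime a n) : ∑ i, α i ^ a = 0 := by
  have hne : NeZero n := ⟨hn.ne'⟩
  have hζ := Complex.isPrimitiveRoot_exp n hn.ne'
  set ζ := Complex.exp (2 * Real.pi * Complex.I / n)
  have : ∀ i, ∃ e, ζ ^ e = α i := fun i => by
    obtain ⟨e, _, he⟩ := hζ.eq_pow_of_pow_eq_one (hα i)
    exact ⟨e, he⟩
  choose e he using this
  let F : Polynomial ℤ := ∑ i, Polynomial.X ^ e i
  have h1 : Polynomial.aeval ζ F = 0 := by simp [F, he, hsum]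
  have h2 : minpoly ℤ ζ ∣ F := minpoly.isIntegrallyClosed_dvd (hζ.isIntegral hn) h1
  rw [hζ.minpoly_eq_pow_coprime ha] at h2
  have h3 : Polynomial.aeval (ζ ^ a) F = 0 := by
    obtain ⟨q, hq⟩ := h2
    rw [hq, map_mul, minpoly.aeval, zero_mul]
  simpa [F, ← he, ← pow_mul, mul_comm] using h3

lemma geom_orth (p : ℕ) (y : ℂ) (hy : y ^ p = 1) :
    ∑ t ∈ Finset.range p, y ^ t = if y = 1 then (p : ℂ) else 0 := by
  split_ifs with h
  · simp [h]
  · have := mul_neg_geom_sum y p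
    rw [hy, sub_self] at this
    rcases mul_eq_zero.1 this with h' | h'
    · exact absurd (sub_eq_zero.1 h').symm h
    · exact h'

lemma class_sum (p : ℕ) (z β : Fin 6 → ℂ) (hz : ∀ i, z i ^ p = 1) (w : ℂ)
    (hw : w ^ p = 1) (hw0 : w ≠ 0) :
    ∑ t ∈ Finset.range p, (∑ i, β i * z i ^ t) * w⁻¹ ^ t
      = p * ∑ i with z i = w, β i := by
  have : ∀ t ∈ Finset.range p, (∑ i, β i * z i ^ t) * w⁻¹ ^ t
      = ∑ i, β i * (z i * w⁻¹) ^ t := by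
    intro t _
    rw [Finset.sum_mul]
    exact Finset.sum_congr rfl fun i _ => by rw [mul_pow]; ring
  rw [Finset.sum_congr rfl this, Finset.sum_comm, Finset.mul_sum, Finset.sum_filter]
  refine Finset.sum_congr rfl fun i _ => ?_
  rw [← Finset.mul_sum, geom_orth p _ (by rw [mul_pow, inv_pow, hw, hz]; simp)]
  simp only [mul_inv_eq_one₀ hw0]
  split_ifs <;> ring

lemma caseA (α : Fin 6 → ℂ) (p m : ℕ) (hp : p.Prime) (hm : 0 < m) (hpm : p ∣ m)
    (hα : ∀ i, α i ^ (p * m) = 1) (hsum : ∑ i, α i = 0)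
    (hmin : ∀ t : Finset (Fin 6), t.Nonempty → t ≠ Finset.univ → ∑ i ∈ t, α i ≠ 0) :
    ∀ i, α i ^ m = α 0 ^ m := by
  have hz : ∀ i, (α i ^ m) ^ p = 1 := fun i => by rw [← pow_mul, mul_comm, hα]
  have h0 : α 0 ^ m ≠ 0 := by
    intro h; have := hz 0; rw [h, zero_pow hp.ne_zero] at this; simp at this
  have h := class_sum p (fun i => α i ^ m) α hz _ (hz 0) h0
  have hs : ∀ t, ∑ i, α i * (α i ^ m) ^ t = 0 := by
    intro t
    have := conj_sum α (p * m) (1 + m * t) (Nat.mul_pos hp.pos hm) hα hsum (by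
      refine Nat.Coprime.mul_right ?_ ?_
      · obtain ⟨c, rfl⟩ := hpm
        simp [mul_assoc]
      · simp)
    rw [← this]
    exact Finset.sum_congr rfl fun i _ => by rw [pow_add, pow_mul, pow_one]
  simp only [hs, zero_mul, Finset.sum_const_zero] at h
  have h2 : ∑ i with α i ^ m = α 0 ^ m, α i = 0 := by
    rcases mul_eq_zero.1 h.symm with h' | h'
    · exact absurd h' (by exact_mod_cast hp.ne_zero)
    · exact h'
  by_contra hc
  push Not at hc
  obtain ⟨i, hi⟩ := hc
  refine hmin _ ⟨0, by simp⟩ ?_ h2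
  intro h3
  have := h3 ▸ Finset.mem_univ i
  simp at this
  exact hi this

lemma caseB (α : Fin 6 → ℂ) (p m : ℕ) (hp : p.Prime) (hm : 0 < m) (hpm : ¬ p ∣ m)
    (hα : ∀ i, α i ^ (p * m) = 1) (hsum : ∑ i, α i = 0)
    (hmin : ∀ t : Finset (Fin 6), t.Nonempty → t ≠ Finset.univ → ∑ i ∈ t, α i ≠ 0) :
    (∀ i, α i ^ m = α 0 ^ m) ∨ ∃ (u : ℕ) (z β : Fin 6 → ℂ) (s : ℂ), s ≠ 0 ∧
      (∀ i, z i = α i ^ u) ∧ (∀ i, z i ^ p = 1) ∧ (∀ i, β i ^ m = 1) ∧ (∀ i, α i = β i * z i) ∧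
      ∀ w : ℂ, w ^ p = 1 → ∑ i with z i = w, β i = s := by
  have hcop : Nat.Coprime p m := (Nat.Prime.coprime_iff_not_dvd hp).2 hpm
  obtain ⟨u, hu1, hu2⟩ := Nat.chineseRemainder hcop 1 0
  have hmu : m ∣ u := (Nat.modEq_zero_iff_dvd).1 hu2
  have hα0 : ∀ i, α i ≠ 0 := by
    intro i h
    have := hα i
    rw [h, zero_pow (Nat.mul_pos hp.pos hm).ne'] at this
    simp at this
  have hz : ∀ i, (α i ^ u) ^ p = 1 := by
    intro i
    obtain ⟨c, rfl⟩ := hmu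
    rw [← pow_mul, show m * c * p = p * m * c by ring, pow_mul, hα, one_pow]
  have hu0 : 1 ≤ u := by
    rcases Nat.eq_zero_or_pos u with h | h
    · subst h
      have := (Nat.modEq_zero_iff_dvd).1 hu1.symm
      exact absurd (Nat.dvd_one.1 this) hp.one_lt.ne'
    · exact h
  obtain ⟨v, rfl⟩ : ∃ v, u = 1 + v := ⟨u - 1, by omega⟩
  have hpv : p ∣ v := by
    have := (Nat.modEq_iff_dvd' hu0).1 hu1.symm
    simpa using this
  have hv1 : ∀ i, (α i ^ v) ^ m = 1 := by
    intro i
    obtain ⟨c, rfl⟩ := hpv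
    rw [← pow_mul, show p * c * m = p * m * c by ring, pow_mul, hα, one_pow]
  let z : Fin 6 → ℂ := fun i => α i ^ (1 + v)
  let β : Fin 6 → ℂ := fun i => (α i ^ v)⁻¹
  have hαz : ∀ i, α i = β i * z i := by
    intro i
    simp only [z, β]
    have := pow_ne_zero v (hα0 i)
    rw [pow_add, pow_one]
    field_simp
  have hs : ∀ t ∈ Finset.range p, t ≠ 0 → ∑ i, β i * z i ^ t = 0 := by
    intro t ht ht0
    obtain ⟨r, rfl⟩ : ∃ r, t = 1 + r := ⟨t - 1, by omega⟩
    have := conj_sum α (p * m) (1 + (1 + v) * r) (Nat.mul_pos hp.pos hm) hα hsum (by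
      refine Nat.Coprime.mul_right ?_ ?_
      · obtain ⟨c, rfl⟩ := hpv
        rw [show 1 + (1 + p * c) * r = (1 + r) + p * (c * r) by ring]
        rw [Nat.coprime_add_mul_left_left]
        exact (Nat.coprime_of_lt_prime (by omega) (Finset.mem_range.1 ht) hp).symm
      · obtain ⟨c, hc⟩ := hmu
        rw [hc]
        simp [mul_assoc])
    rw [← this]
    refine Finset.sum_congr rfl fun i _ => ?_
    rw [pow_add (z i), pow_one, ← mul_assoc, ← hαz, pow_add _ 1, pow_one, pow_mul]
  have hcl : ∀ w : ℂ, w ^ p = 1 → ∑ i with z i = w, β i = (∑ i, β i) / p := by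
    intro w hw
    have hw0 : w ≠ 0 := by
      rintro rfl; rw [zero_pow hp.ne_zero] at hw; simp at hw
    have h := class_sum p z β hz w hw hw0
    rw [Finset.sum_eq_single_of_mem 0 (by simp [hp.pos])
      (fun t ht ht0 => by rw [hs t ht ht0, zero_mul])] at h
    have : (p : ℂ) ≠ 0 := by exact_mod_cast hp.ne_zero
    rw [eq_div_iff this, mul_comm, ← h]
    simp
  by_cases hs0 : (∑ i, β i) / p = 0
  · left
    have h2 : ∑ i with z i = z 0, α i = 0 := by
      rw [← mul_zero (z 0), ← hs0, ← hcl (z 0) (hz 0), Finset.mul_sum]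
      refine Finset.sum_congr rfl fun i hi => ?_
      rw [hαz i, (Finset.mem_filter.1 hi).2, mul_comm]
    have hzz : ∀ i, z i = z 0 := by
      by_contra hc
      push Not at hc
      obtain ⟨i, hi⟩ := hc
      refine hmin _ ⟨0, by simp⟩ ?_ h2
      intro h3
      have := h3 ▸ Finset.mem_univ i
      simp at this
      exact hi this
    intro i
    rw [hαz i, hαz 0, mul_pow, mul_pow, hzz i]
    simp [β, hv1]
  · right
    exact ⟨1 + v, z, β, _, hs0, fun i => rfl, hz, fun i => by simp [β, hv1], hαz, hcl⟩

lemma class_nonempty {p : ℕ} {z β : Fin 6 → ℂ} {s : ℂ} (hs : s ≠ 0)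
    (hcl : ∀ w : ℂ, w ^ p = 1 → ∑ i with z i = w, β i = s) (w : ℂ) (hw : w ^ p = 1) :
    ∃ i, z i = w := by
  by_contra hc
  push Not at hc
  apply hs
  rw [← hcl w hw, Finset.sum_eq_zero]
  intro i hi
  exact absurd (Finset.mem_filter.1 hi).2 (hc i)

lemma index_surj {p : ℕ} (hp : 0 < p) {z β : Fin 6 → ℂ} {s : ℂ} (hs : s ≠ 0)
    {ρ : ℂ} (hρ : IsPrimitiveRoot ρ p) (hz : ∀ i, z i ^ p = 1)
    (hcl : ∀ w : ℂ, w ^ p = 1 → ∑ i with z i = w, β i = s) :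
    ∃ k : Fin 6 → Fin p, Function.Surjective k ∧ ∀ i, z i = ρ ^ (k i : ℕ) := by
  have hne : NeZero p := ⟨hp.ne'⟩
  have : ∀ i, ∃ k : Fin p, z i = ρ ^ (k : ℕ) := fun i => by
    obtain ⟨e, he, h⟩ := hρ.eq_pow_of_pow_eq_one (hz i)
    exact ⟨⟨e, he⟩, h.symm⟩
  choose k hk using this
  refine ⟨k, fun j => ?_, hk⟩
  obtain ⟨i, hi⟩ := class_nonempty hs hcl (ρ ^ (j : ℕ))
    (by rw [← pow_mul, mul_comm, pow_mul, hρ.pow_eq_one, one_pow])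
  refine ⟨i, Fin.ext (hρ.pow_inj (k i).2 j.2 ?_)⟩
  rw [← hk, hi]

lemma hexagon (a b : ℂ) (m : ℕ) (hm : 0 < m) (ha : a ^ m = 1) (hb : b ^ m = 1) (hab : a + b = 1) :
    a * b = 1 := by
  have na : ‖a‖ = 1 := Complex.norm_eq_one_of_pow_eq_one ha hm.ne'
  have nb : ‖b‖ = 1 := Complex.norm_eq_one_of_pow_eq_one hb hm.ne'
  have h1 : a * (starRingEnd ℂ) a = 1 := by rw [Complex.mul_conj']; simp [na]
  have h2 : b * (starRingEnd ℂ) b = 1 := by rw [Complex.mul_conj']; simp [nb]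
  have h3 : (starRingEnd ℂ) a + (starRingEnd ℂ) b = 1 := by rw [← map_add, hab, map_one]
  linear_combination -(a * b) * h3 + b * h1 + a * h2 + hab

lemma hexagon_root (ω a b : ℂ) (hω : ω ^ 2 + ω + 1 = 0) (hab : a + b = 1) (h : a * b = 1) :
    (a = -ω ∧ b = -ω ^ 2) ∨ (a = -ω ^ 2 ∧ b = -ω) := by
  have h1 : (a + ω) * (a + ω ^ 2) = 0 := by
    linear_combination a * hab - h + (a + ω - 1) * hω
  rcases mul_eq_zero.1 h1 with h2 | h2
  · exact Or.inl ⟨by linear_combination h2, by linear_combination hab - h2 + hω⟩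
  · exact Or.inr ⟨by linear_combination h2, by linear_combination hab - h2 + hω⟩

lemma five (α : Fin 6 → ℂ) (m u : ℕ) (hm : 0 < m) (z β : Fin 6 → ℂ) (s ρ ω : ℂ) (hs : s ≠ 0)
    (hρ : IsPrimitiveRoot ρ 5) (hω : ω ^ 2 + ω + 1 = 0)
    (hzα : ∀ i, z i = α i ^ u) (hz : ∀ i, z i ^ 5 = 1) (hβ : ∀ i, β i ^ m = 1)
    (hα : ∀ i, α i = β i * z i)
    (hcl : ∀ w : ℂ, w ^ 5 = 1 → ∑ i with z i = w, β i = s) :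
    ∃ (x : ℂ) (σ : Equiv.Perm (Fin 6)), (∃ m : ℕ, 0 < m ∧ x ^ m = 1) ∧
      ∀ i, α i = x * ![ρ, ρ ^ 2, ρ ^ 3, ρ ^ 4, -ω, -ω ^ 2] (σ i) := by
  obtain ⟨k, hk, hzk⟩ := index_surj (by norm_num) hs hρ hz hcl
  obtain ⟨a, b, hab, hkab⟩ := Fintype.exists_ne_map_eq_of_card_lt k (by simp)
  -- off `b`, the index map is injective
  have hinj : ∀ i j, i ≠ b → j ≠ b → k i = k j → i = j := by
    let f : {i : Fin 6 // i ≠ b} → Fin 5 := fun i => k i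
    have hf : Function.Surjective f := by
      intro y
      obtain ⟨i, hi⟩ := hk y
      by_cases h : i = b
      · exact ⟨⟨a, hab⟩, by simp only [f]; rw [hkab, ← h, hi]⟩
      · exact ⟨⟨i, h⟩, hi⟩
    have hfi : Function.Injective f :=
      ((Fintype.bijective_iff_surjective_and_card f).2 ⟨hf, by simp [Fintype.card_subtype_compl]⟩).1
    intro i j hi hj h
    have := @hfi ⟨i, hi⟩ ⟨j, hj⟩ h
    simpa using this
  have hzinj : ∀ i j, z i = z j → k i = k j := by
    intro i j h
    rw [hzk, hzk] at h
    exact Fin.ext (hρ.pow_inj (k i).2 (k j).2 h)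
  have hzab : z a = z b := by rw [hzk, hzk, hkab]
  have h1 : ∀ i, i ≠ a → i ≠ b → β i = s := by
    intro i hia hib
    have := hcl (z i) (hz i)
    rw [show (Finset.univ.filter fun j => z j = z i) = {i} from ?_] at this
    · simpa using this
    · ext j
      simp only [Finset.mem_filter, Finset.mem_univ, true_and, Finset.mem_singleton]
      refine ⟨fun h => ?_, fun h => by rw [h]⟩
      by_cases hj : j = b
      · exfalso
        apply hia
        apply hinj _ _ hib hab
        rw [hkab, ← hj, hzinj _ _ h]
      · exact hinj _ _ hj hib (hzinj _ _ h)
  have h2 : β a + β b = s := by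
    have := hcl (z a) (hz a)
    rw [show (Finset.univ.filter fun j => z j = z a) = {a, b} from ?_, Finset.sum_pair hab] at this
    · exact this
    · ext j
      simp only [Finset.mem_filter, Finset.mem_univ, true_and, Finset.mem_singleton,
        Finset.mem_insert]
      constructor
      · intro h
        by_cases hj : j = b
        · exact Or.inr hj
        · exact Or.inl (hinj _ _ hj hab (hzinj _ _ h))
      · rintro (h | h)
        · rw [h]
        · rw [h, hzab]
  obtain ⟨c, hca, hcb⟩ : ∃ c, c ≠ a ∧ c ≠ b := by
    have hdec : ∀ a b : Fin 6, ∃ c, c ≠ a ∧ c ≠ b := by decide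
    exact hdec a b
  have hsm : s ^ m = 1 := by rw [← h1 c hca hcb, hβ]
  have h3 : β a / s + β b / s = 1 := by rw [← add_div, h2, div_self hs]
  have h4 : β a / s * (β b / s) = 1 :=
    hexagon _ _ m hm (by rw [div_pow, hβ, hsm, div_one]) (by rw [div_pow, hβ, hsm, div_one]) h3
  have h5 := hexagon_root ω _ _ hω h3 h4
  have hβab : β a ≠ β b := by
    intro h
    rw [h] at h3 h4
    have : (4 : ℂ) = 1 := by linear_combination (-4 : ℂ) * h4 + (2 * (β b / s) + 1) * h3
    norm_num at this
  have hαinj : Function.Injective α := by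
    intro i j hij
    have hzz : z i = z j := by rw [hzα, hzα, hij]
    have hz0 : z j ≠ 0 := by
      intro h; have := hz j; rw [h] at this; norm_num at this
    have hββ : β i = β j := by
      have := hij
      rw [hα i, hα j, hzz] at this
      exact mul_right_cancel₀ hz0 this
    by_cases hi : i = b
    · by_cases hj : j = b
      · rw [hi, hj]
      · have : j = a := hinj _ _ hj hab (by rw [hkab, ← hi, hzinj _ _ hzz])
        exact absurd (by rw [← hi, ← this, hββ]) hβab
    · by_cases hj : j = b
      · have : i = a := hinj _ _ hi hab (by rw [hkab, ← hj, hzinj _ _ hzz])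
        exact absurd (by rw [← hj, ← this, hββ]) hβab
      · exact hinj _ _ hi hj (hzinj _ _ hzz)
  have key : ∀ i, ∃ j, α i = (s * z a) * ![ρ, ρ ^ 2, ρ ^ 3, ρ ^ 4, -ω, -ω ^ 2] j := by
    intro i
    by_cases hia : i = a
    · have e : α i = s * z a * (β a / s) := by rw [hia, hα]; field_simp
      rcases h5 with ⟨h, _⟩ | ⟨h, _⟩
      · exact ⟨4, by rw [e, h]; rfl⟩
      · exact ⟨5, by rw [e, h]; rfl⟩
    by_cases hib : i = b
    · have e : α i = s * z a * (β b / s) := by rw [hib, hα, hzab]; field_simp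
      rcases h5 with ⟨_, h⟩ | ⟨_, h⟩
      · exact ⟨5, by rw [e, h]; rfl⟩
      · exact ⟨4, by rw [e, h]; rfl⟩
    have hza0 : z a ≠ 0 := by
      intro h; have := hz a; rw [h] at this; norm_num at this
    have hne : z i / z a ≠ 1 := by
      intro h
      rw [div_eq_one_iff_eq hza0] at h
      exact hia (hinj _ _ hib hab (hzinj _ _ h))
    have e : α i = s * z a * (z i / z a) := by rw [hα, h1 i hia hib]; field_simp
    obtain ⟨q, hq, hq'⟩ := hρ.eq_pow_of_pow_eq_one (show (z i / z a) ^ 5 = 1 by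
      rw [div_pow, hz, hz, div_one])
    rw [e, ← hq']
    rw [← hq'] at hne
    interval_cases q
    · simp at hne
    · exact ⟨0, by simp⟩
    · exact ⟨1, by simp⟩
    · exact ⟨2, by simp⟩
    · exact ⟨3, by simp⟩
  choose σ hσ using key
  have hσi : Function.Injective σ := by
    intro i j h
    apply hαinj
    rw [hσ i, hσ j, h]
  refine ⟨s * z a, Equiv.ofBijective σ (Finite.injective_iff_bijective.1 hσi),
    ⟨m * 5, by omega, ?_⟩, hσ⟩
  rw [mul_pow, pow_mul, hsm, mul_comm m 5, pow_mul (z a), hz]; simp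

lemma three (α : Fin 6 → ℂ) (m : ℕ) (hm : m ∣ 2) (z β : Fin 6 → ℂ) (s ρ : ℂ) (hs : s ≠ 0)
    (hρ : IsPrimitiveRoot ρ 3)
    (hz : ∀ i, z i ^ 3 = 1) (hβ : ∀ i, β i ^ m = 1)
    (hα : ∀ i, α i = β i * z i)
    (hcl : ∀ w : ℂ, w ^ 3 = 1 → ∑ i with z i = w, β i = s)
    (hmin : ∀ t : Finset (Fin 6), t.Nonempty → t ≠ Finset.univ → ∑ i ∈ t, α i ≠ 0) : False := by
  have hβ2 : ∀ i, β i = 1 ∨ β i = -1 := by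
    intro i
    rw [← sq_eq_one_iff]
    obtain ⟨c, hc⟩ := hm
    rw [hc, pow_mul, hβ, one_pow]
  have him : ∀ i, (β i).im = 0 := fun i => by rcases hβ2 i with h | h <;> simp [h]
  have hsim : s.im = 0 := by
    rw [← hcl 1 (by simp), Complex.im_sum]
    exact Finset.sum_eq_zero fun i _ => him i
  have hsre : s.re ≠ 0 := fun h => hs (Complex.ext h hsim)
  -- every class contains an element with the sign of `s`
  have hsign : ∃ e : ℂ, ∀ w : ℂ, w ^ 3 = 1 → ∃ i, z i = w ∧ β i = e := by
    rcases lt_or_gt_of_ne hsre with h | h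
    · refine ⟨-1, fun w hw => ?_⟩
      by_contra hc
      push Not at hc
      rw [← hcl w hw, Complex.re_sum] at h
      refine absurd h (not_lt.2 (Finset.sum_nonneg fun i hi => ?_))
      rcases hβ2 i with h' | h'
      · simp [h']
      · exact absurd h' (hc i (Finset.mem_filter.1 hi).2)
    · refine ⟨1, fun w hw => ?_⟩
      by_contra hc
      push Not at hc
      rw [← hcl w hw, Complex.re_sum] at h
      refine absurd h (not_lt.2 (Finset.sum_nonpos fun i hi => ?_))
      rcases hβ2 i with h' | h'
      · exact absurd h' (hc i (Finset.mem_filter.1 hi).2)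
      · simp [h']
  obtain ⟨e, he⟩ := hsign
  obtain ⟨i, hi, hi'⟩ := he 1 (by simp)
  obtain ⟨j, hj, hj'⟩ := he ρ hρ.pow_eq_one
  obtain ⟨l, hl, hl'⟩ := he (ρ ^ 2) (by rw [← pow_mul, mul_comm, pow_mul, hρ.pow_eq_one, one_pow])
  have h0 : 1 + ρ + ρ ^ 2 = 0 := by
    have := hρ.geom_sum_eq_zero (by norm_num)
    simpa [Finset.sum_range_succ] using this
  have hρ1 : ρ ≠ 1 := hρ.ne_one (by norm_num)
  have hρ21 : ρ ^ 2 ≠ 1 := hρ.pow_ne_one_of_pos_of_lt (by norm_num) (by norm_num)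
  have hρ2 : ρ ≠ ρ ^ 2 := by
    intro h
    have h7 : (1 : ℕ) = 2 := hρ.pow_inj (by norm_num) (by norm_num) (by simpa using h)
    norm_num at h7
  have hij : i ≠ j := by rintro rfl; exact hρ1 (hj ▸ hi)
  have hil : i ≠ l := by rintro rfl; exact hρ21 (hl ▸ hi)
  have hjl : j ≠ l := by rintro rfl; exact hρ2 (hj.symm.trans hl)
  refine hmin {i, j, l} ⟨i, by simp⟩ ?_ ?_
  · intro h
    have h8 := congrArg Finset.card h
    have h9 : ({i, j, l} : Finset (Fin 6)).card ≤ 3 := Finset.card_le_three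
    rw [h8] at h9
    simp at h9
  · rw [Finset.sum_insert (by simp [hij, hil]), Finset.sum_pair hjl, hα, hα, hα, hi, hj, hl,
      hi', hj', hl']
    linear_combination e * h0

lemma two (α : Fin 6 → ℂ) (z β : Fin 6 → ℂ) (s : ℂ) (hs : s ≠ 0)
    (hβ : ∀ i, β i = 1)
    (hα : ∀ i, α i = β i * z i)
    (hcl : ∀ w : ℂ, w ^ 2 = 1 → ∑ i with z i = w, β i = s)
    (hmin : ∀ t : Finset (Fin 6), t.Nonempty → t ≠ Finset.univ → ∑ i ∈ t, α i ≠ 0) : False := by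
  obtain ⟨i, hi⟩ := class_nonempty hs hcl 1 (by simp)
  obtain ⟨j, hj⟩ := class_nonempty hs hcl (-1) (by simp)
  have hij : i ≠ j := by rintro rfl; rw [hi] at hj; norm_num at hj
  refine hmin {i, j} ⟨i, by simp⟩ ?_ ?_
  · intro h
    have h8 := congrArg Finset.card h
    have h9 : ({i, j} : Finset (Fin 6)).card ≤ 2 := Finset.card_le_two
    rw [h8] at h9
    simp at h9
  · rw [Finset.sum_pair hij, hα, hα, hi, hj, hβ, hβ]; norm_num

lemma norm_case (α : Fin 6 → ℂ) (n : ℕ) (hn : 0 < n) (hα : ∀ i, α i ^ n = 1)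
    (ρ ω : ℂ) (hρ : IsPrimitiveRoot ρ 5) (hω : IsPrimitiveRoot ω 3)
    (hsum : ∑ i, α i = 0)
    (hmin : ∀ t : Finset (Fin 6), t.Nonempty → t ≠ Finset.univ → ∑ i ∈ t, α i ≠ 0)
    (hnmin : ∀ m, 0 < m → m < n → ¬ ∀ i, α i ^ m = α 0 ^ m) :
    ∃ (x : ℂ) (σ : Equiv.Perm (Fin 6)), (∃ m : ℕ, 0 < m ∧ x ^ m = 1) ∧
      ∀ i, α i = x * ![ρ, ρ ^ 2, ρ ^ 3, ρ ^ 4, -ω, -ω ^ 2] (σ i) := by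
  have red : ∀ p m, p.Prime → n = p * m → 0 < m ∧ ¬ p ∣ m ∧
      ∃ (u : ℕ) (z β : Fin 6 → ℂ) (s : ℂ), s ≠ 0 ∧
      (∀ i, z i = α i ^ u) ∧ (∀ i, z i ^ p = 1) ∧ (∀ i, β i ^ m = 1) ∧ (∀ i, α i = β i * z i) ∧
      ∀ w : ℂ, w ^ p = 1 → ∑ i with z i = w, β i = s := by
    intro p m hp hpm
    have hm : 0 < m := by
      rcases Nat.eq_zero_or_pos m with h | h
      · rw [h] at hpm; omega
      · exact h
    have hlt : m < n := by rw [hpm]; exact lt_mul_of_one_lt_left hm hp.one_lt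
    rw [hpm] at hα
    have hd : ¬ p ∣ m := fun h => hnmin m hm hlt (caseA α p m hp hm h hα hsum hmin)
    exact ⟨hm, hd, (caseB α p m hp hm hd hα hsum hmin).resolve_left (hnmin m hm hlt)⟩
  have hprime : ∀ p, p.Prime → p ∣ n → p = 2 ∨ p = 3 ∨ p = 5 := by
    rintro p hp ⟨m, hpm⟩
    obtain ⟨_, _, u, z, β, s, hs, _, hz, _, _, hcl⟩ := red p m hp hpm
    obtain ⟨k, hk, _⟩ :=
      index_surj hp.pos hs (Complex.isPrimitiveRoot_exp p hp.ne_zero) hz hcl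
    have := Fintype.card_le_of_surjective k hk
    simp at this
    interval_cases p <;> revert hp <;> decide
  have hω0 : ω ^ 2 + ω + 1 = 0 := by
    have := hω.geom_sum_eq_zero (by norm_num)
    simp [Finset.sum_range_succ] at this
    linear_combination this
  by_cases h5 : 5 ∣ n
  · obtain ⟨m, hm⟩ := h5
    obtain ⟨hm0, _, u, z, β, s, hs, hzα, hz, hβ, hαz, hcl⟩ := red 5 m (by norm_num) hm
    exact five α m u hm0 z β s ρ ω hs hρ hω0 hzα hz hβ hαz hcl
  exfalso
  by_cases h3 : 3 ∣ n
  · obtain ⟨m, hm⟩ := h3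
    obtain ⟨hm0, hd, u, z, β, s, hs, hzα, hz, hβ, hαz, hcl⟩ := red 3 m (by norm_num) hm
    have hm2 : m ∣ 2 := by
      by_cases h1 : m = 1
      · simp [h1]
      have hq : ∀ q, q.Prime → q ∣ m → q = 2 := by
        intro q hq hqm
        rcases hprime q hq (hm ▸ hqm.mul_left 3) with h | h | h
        · exact h
        · exact absurd (h ▸ hqm) hd
        · exact absurd (hm ▸ (h ▸ hqm).mul_left 3) h5
      obtain ⟨l, hl⟩ : 2 ∣ m := by
        have := hq _ (Nat.minFac_prime h1) (Nat.minFac_dvd m)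
        exact this ▸ Nat.minFac_dvd m
      by_cases hl1 : l = 1
      · simp [hl, hl1]
      have h2l := hq _ (Nat.minFac_prime hl1) ((Nat.minFac_dvd l).trans ⟨2, by rw [hl]; ring⟩)
      have h2l' : 2 ∣ l := h2l ▸ Nat.minFac_dvd l
      exact absurd (h2l'.mul_left 3) (red 2 (3 * l) (by norm_num) (by rw [hm, hl]; ring)).2.1
    exact three α m hm2 z β s ω hs hω hz hβ hαz hcl hmin
  by_cases h1 : n = 1
  · subst h1
    simp only [pow_one] at hα
    simp [hα] at hsum
  have hq : ∀ q, q.Prime → q ∣ n → q = 2 := by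
    intro q hq hqm
    rcases hprime q hq hqm with h | h | h
    · exact h
    · exact absurd (h ▸ hqm) h3
    · exact absurd (h ▸ hqm) h5
  obtain ⟨m, hm⟩ : 2 ∣ n := by
    have := hq _ (Nat.minFac_prime h1) (Nat.minFac_dvd n)
    exact this ▸ Nat.minFac_dvd n
  obtain ⟨hm0, hd, u, z, β, s, hs, hzα, hz, hβ, hαz, hcl⟩ := red 2 m (by norm_num) hm
  by_cases hm1 : m = 1
  · subst hm1
    exact two α z β s hs (fun i => by simpa using hβ i) hαz hcl hmin
  · have h2 := hq _ (Nat.minFac_prime hm1) ((Nat.minFac_dvd m).trans ⟨2, by rw [hm]; ring⟩)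
    exact hd (h2 ▸ Nat.minFac_dvd m)


theorem stmt19 (α : Fin 6 → ℂ) (hroot : ∀ i, ∃ m : ℕ, 0 < m ∧ α i ^ m = 1)
    (hsum : ∑ i, α i = 0)
    (hmin : ∀ t : Finset (Fin 6), t.Nonempty → t ≠ Finset.univ → ∑ i ∈ t, α i ≠ 0) :
    ∃ (x : ℂ) (σ : Equiv.Perm (Fin 6)), (∃ m : ℕ, 0 < m ∧ x ^ m = 1) ∧
      ∀ i, α i = x *
        ![Complex.exp (2 * (Real.pi : ℂ) * Complex.I / 5),
          Complex.exp (2 * (Real.pi : ℂ) * Complex.I / 5) ^ 2,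
          Complex.exp (2 * (Real.pi : ℂ) * Complex.I / 5) ^ 3,
          Complex.exp (2 * (Real.pi : ℂ) * Complex.I / 5) ^ 4,
          -Complex.exp (2 * (Real.pi : ℂ) * Complex.I / 3),
          -Complex.exp (2 * (Real.pi : ℂ) * Complex.I / 3) ^ 2] (σ i) := by
  classical
  have hρ : IsPrimitiveRoot (Complex.exp (2 * (Real.pi : ℂ) * Complex.I / 5)) 5 := by
    have := Complex.isPrimitiveRoot_exp 5 (by norm_num)
    simpa using this
  have hω : IsPrimitiveRoot (Complex.exp (2 * (Real.pi : ℂ) * Complex.I / 3)) 3 := by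
    have := Complex.isPrimitiveRoot_exp 3 (by norm_num)
    simpa using this
  set ρ := Complex.exp (2 * (Real.pi : ℂ) * Complex.I / 5)
  set ω := Complex.exp (2 * (Real.pi : ℂ) * Complex.I / 3)
  have hex : ∃ n : ℕ, 0 < n ∧ ∃ x : ℂ, (∃ m : ℕ, 0 < m ∧ x ^ m = 1) ∧
      ∀ i, (x * α i) ^ n = 1 := by
    choose m hm hm' using hroot
    refine ⟨∏ i, m i, Finset.prod_pos fun i _ => hm i, 1, ⟨1, by simp⟩, fun i => ?_⟩
    obtain ⟨c, hc⟩ := Finset.dvd_prod_of_mem m (Finset.mem_univ i)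
    rw [hc, one_mul, pow_mul, hm', one_pow]
  obtain ⟨hn, x, ⟨q, hq, hxq⟩, hx⟩ := Nat.find_spec hex
  have hmin' := fun m (h : m < Nat.find hex) => Nat.find_min hex h
  set n := Nat.find hex
  have hx0 : x ≠ 0 := by
    rintro rfl; rw [zero_pow hq.ne'] at hxq; simp at hxq
  obtain ⟨y, σ, ⟨r, hr, hyr⟩, h⟩ := norm_case (fun i => x * α i) n hn hx ρ ω hρ hω
    (by rw [← Finset.mul_sum, hsum, mul_zero])
    (fun t ht ht' h => by
      rw [← Finset.mul_sum] at h
      exact (mul_ne_zero hx0 (hmin t ht ht')) h)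
    (fun m hm hmn hall => by
      refine hmin' m hmn ⟨hm, (x * α 0)⁻¹ * x, ⟨n * q, Nat.mul_pos hn hq, ?_⟩, fun i => ?_⟩
      · rw [mul_pow, inv_pow, pow_mul, hx, mul_comm n q, pow_mul x, hxq]; simp
      · have hne : x * α 0 ≠ 0 := by
          intro h0; have := hx 0; rw [h0, zero_pow hn.ne'] at this; simp at this
        have h1 := hall i
        rw [mul_assoc, mul_pow, h1, inv_pow, inv_mul_cancel₀ (pow_ne_zero _ hne)])
  refine ⟨x⁻¹ * y, σ, ⟨q * r, Nat.mul_pos hq hr, ?_⟩, fun i => ?_⟩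
  · rw [mul_pow, inv_pow, pow_mul, hxq, mul_comm q r, pow_mul y, hyr]; simp
  · rw [mul_assoc, ← h i, inv_mul_cancel_left₀ hx0]
end
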